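/- arXiv:1007.3921 — 7 statements merged into one kernel-verified Lean document; each statement's English description precedes it below -/
import Mathlib

section
/- Let f : [0,+∞) → ℝ be locally Lipschitz-continuous with f(0) ≥ 0. Then every V ∈ R_f has a finite limit z₀(V) = lim_{ξ→+∞} V(ξ), this limit belongs to Z_f, V'(0)² = 2F(z₀(V)), and the map V ↦ z₀(V) is a bijection from R_f onto Z_f. -/
open Set Filter

noncomputable section

/-- Partial derivative of `u` in the `i`-th coordinate direction. -/
def pd {N : ℕ} (i : Fin N) (u : (Fin N → ℝ) → ℝ) (x : Fin N → ℝ) : ℝ :=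
  deriv (fun t => u (Function.update x i t)) (x i)

/-- Laplace operator: the sum of the pure second partial derivatives. -/
def lap {N : ℕ} (u : (Fin N → ℝ) → ℝ) (x : Fin N → ℝ) : ℝ :=
  ∑ i, pd i (pd i u) x

/-- `f` is locally Lipschitz-continuous on `[0, +∞)`. -/
def LocLipOn (f : ℝ → ℝ) : Prop :=
  ∀ b : ℝ, ∃ L : NNReal, LipschitzOnWith L f (Set.Icc 0 b)

/-- Hypothesis (H1): `f` is locally Lipschitz on `[0,∞)`, positive on `(0,μ)`, nonpositive on
`[μ,∞)`, nonincreasing on `[μ',μ]`, and either `f(0) > 0` or `f(0) = 0` with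
`liminf_{s→0⁺} f(s)/s > 0`. -/
def H1 (f : ℝ → ℝ) (μ' μ : ℝ) : Prop :=
  LocLipOn f ∧ 0 < μ' ∧ μ' < μ ∧
  (∀ s, 0 < s → s < μ → 0 < f s) ∧
  (∀ s, μ ≤ s → f s ≤ 0) ∧
  (∀ s t, μ' ≤ s → s ≤ t → t ≤ μ → f t ≤ f s) ∧
  (0 < f 0 ∨ (f 0 = 0 ∧ ∃ c > 0, ∀ᶠ s in nhdsWithin (0:ℝ) (Set.Ioi 0), c ≤ f s / s))

/-- Hypothesis (H2): `f` is locally Lipschitz and nonnegative on `[0,∞)`, and at every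
nonnegative zero `z` of `f`, `liminf_{s→z⁺} f(s)/(s-z) > 0`. -/
def H2 (f : ℝ → ℝ) : Prop :=
  LocLipOn f ∧ (∀ s, 0 ≤ s → 0 ≤ f s) ∧
  (∀ z, 0 ≤ z → f z = 0 → ∃ c > 0, ∀ᶠ s in nhdsWithin z (Set.Ioi z), c ≤ f s / (s - z))

/-- Hypothesis (H3): `liminf_{s→z⁻} f(s)/(s-z) > 0` for every zero `z > μ` of `f`. -/
def H3 (f : ℝ → ℝ) (μ : ℝ) : Prop :=
  ∀ z, μ < z → f z = 0 → ∃ c > 0, ∀ᶠ s in nhdsWithin z (Set.Iio z), c ≤ f s / (s - z)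

/-- `(V, V')` is a `C²` solution on `[0,+∞)` of `V'' + f(V) = 0` with `V(0) = 0`,
`0 < V < z` on `(0,+∞)` and `V(+∞) = z` (the one-dimensional profile `V_z`). -/
def IsProfile (f : ℝ → ℝ) (z : ℝ) (V V' : ℝ → ℝ) : Prop :=
  (∀ ξ ∈ Set.Ici (0:ℝ), HasDerivWithinAt V (V' ξ) (Set.Ici 0) ξ) ∧
  (∀ ξ ∈ Set.Ici (0:ℝ), HasDerivWithinAt V' (-(f (V ξ))) (Set.Ici 0) ξ) ∧
  V 0 = 0 ∧ (∀ ξ, 0 < ξ → 0 < V ξ ∧ V ξ < z) ∧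
  Filter.Tendsto V Filter.atTop (nhds z)

/-- The translates `x ↦ u(x + h e₁)` converge as `h → +∞`, uniformly on `K` together with all
partial derivatives up to order two, to the limits `w`, `w1 i`, `w2 i j`. -/
def C2ConvOn {N : ℕ} (i0 : Fin N) (u : (Fin N → ℝ) → ℝ) (K : Set (Fin N → ℝ))
    (w : (Fin N → ℝ) → ℝ) (w1 : Fin N → (Fin N → ℝ) → ℝ)
    (w2 : Fin N → Fin N → (Fin N → ℝ) → ℝ) : Prop :=
  TendstoUniformlyOn (fun (h : ℝ) x => u (Function.update x i0 (x i0 + h))) w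
    Filter.atTop K ∧
  (∀ i, TendstoUniformlyOn (fun (h : ℝ) x => pd i u (Function.update x i0 (x i0 + h)))
      (w1 i) Filter.atTop K) ∧
  (∀ i j, TendstoUniformlyOn
      (fun (h : ℝ) x => pd i (pd j u) (Function.update x i0 (x i0 + h)))
      (w2 i j) Filter.atTop K)

/-- `F(z) = ∫₀^z f(σ) dσ`. -/
def Ff (f : ℝ → ℝ) (z : ℝ) : ℝ := ∫ σ in (0:ℝ)..z, f σ

/-- The set `Z_f = {z₀ ≥ 0 : f(z₀) = 0 and F(z) < F(z₀) for all z ∈ [0,z₀)}`. -/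
def Zf (f : ℝ → ℝ) : Set ℝ :=
  {z | 0 ≤ z ∧ f z = 0 ∧ ∀ w, 0 ≤ w → w < z → Ff f w < Ff f z}

/-- `(V, V')` belongs to `R_f`: a bounded nonnegative `C²` solution on `[0,∞)` of
`V'' + f(V) = 0` with `V(0) = 0`. -/
def InRf (f V V' : ℝ → ℝ) : Prop :=
  (∀ ξ ∈ Set.Ici (0:ℝ), HasDerivWithinAt V (V' ξ) (Set.Ici 0) ξ) ∧
  (∀ ξ ∈ Set.Ici (0:ℝ), HasDerivWithinAt V' (-(f (V ξ))) (Set.Ici 0) ξ) ∧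
  V 0 = 0 ∧ (∀ ξ, 0 ≤ ξ → 0 ≤ V ξ) ∧ (∃ C, ∀ ξ, 0 ≤ ξ → V ξ ≤ C)

theorem LocLipOn.continuousOn {f : ℝ → ℝ} (hf : LocLipOn f) : ContinuousOn f (Ici 0) := by
  intro x hx
  obtain ⟨L, hL⟩ := hf (x + 1)
  have hx' : (0 : ℝ) ≤ x := hx
  refine (hL.continuousOn x ⟨hx, by linarith⟩).mono_of_mem_nhdsWithin ?_
  rw [← Ici_inter_Iic]
  exact Filter.inter_mem self_mem_nhdsWithin (mem_nhdsWithin_of_mem_nhds (Iic_mem_nhds (by linarith)))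

theorem LocLipOn.hasDerivWithinAt_Ff {f : ℝ → ℝ} (hf : LocLipOn f) {x : ℝ} (hx : 0 ≤ x) :
    HasDerivWithinAt (Ff f) (f x) (Ici 0) x := by
  have hg : Continuous fun y => f (max y 0) :=
    hf.continuousOn.comp_continuous (by fun_prop) fun y => le_max_right y 0
  have h := ((hg.integral_hasStrictDerivAt 0 x).hasDerivAt).hasDerivWithinAt (s := Ici 0)
  simp only [max_eq_left hx] at h
  have key : ∀ y ∈ Ici (0 : ℝ), Ff f y = ∫ s in (0 : ℝ)..y, f (max s 0) := by
    intro y hy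
    refine intervalIntegral.integral_congr fun s hs => ?_
    rw [uIcc_of_le hy] at hs
    simp only [max_eq_left hs.1]
  exact h.congr key (key x hx)

theorem Ff_zero (f : ℝ → ℝ) : Ff f 0 = 0 := intervalIntegral.integral_same

/-- Mean value theorem for functions differentiable on `[0, ∞)`. -/
theorem exists_sub_eq_mul_of_hasDerivWithinAt_Ici {u u' : ℝ → ℝ}
    (hu : ∀ t ∈ Ici (0 : ℝ), HasDerivWithinAt u (u' t) (Ici 0) t) {a b : ℝ} (ha : 0 ≤ a)
    (hab : a < b) : ∃ c ∈ Ioo a b, u b - u a = u' c * (b - a) := by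
  obtain ⟨c, hc, h⟩ := exists_hasDerivAt_eq_slope u u' hab
    (fun t ht => (hu t (ha.trans ht.1)).continuousWithinAt.mono fun s hs => ha.trans hs.1)
    (fun t ht => (hu t (ha.trans ht.1.le)).hasDerivAt (Ici_mem_nhds (ha.trans_lt ht.1)))
  refine ⟨c, hc, ?_⟩
  rw [h, div_mul_cancel₀ _ (sub_ne_zero.2 hab.ne')]

/-- If a function converges at infinity and so does its derivative, the derivative tends to 0. -/
theorem eq_zero_of_tendsto_of_tendsto_deriv {u u' : ℝ → ℝ} {a b : ℝ}
    (hu : ∀ t ∈ Ici (0 : ℝ), HasDerivWithinAt u (u' t) (Ici 0) t)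
    (ha : Tendsto u atTop (nhds a)) (hb : Tendsto u' atTop (nhds b)) : b = 0 := by
  have h : ∀ t : ℝ, ∃ c, t ≤ c ∧ (0 ≤ t → u (t + 1) - u t = u' c) := by
    intro t
    by_cases ht : 0 ≤ t
    · obtain ⟨c, hc, h⟩ := exists_sub_eq_mul_of_hasDerivWithinAt_Ici hu ht (lt_add_one t)
      exact ⟨c, hc.1.le, fun _ => by rw [h]; ring⟩
    · exact ⟨t, le_rfl, fun h => absurd h ht⟩
  choose c hc h using h
  have h1 : Tendsto (fun t => u' (c t)) atTop (nhds b) := hb.comp (tendsto_atTop_mono hc tendsto_id)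
  have h2 : Tendsto (fun t => u (t + 1) - u t) atTop (nhds (a - a)) :=
    (ha.comp (tendsto_atTop_add_const_right _ 1 tendsto_id)).sub ha
  rw [sub_self] at h2
  refine tendsto_nhds_unique h1 (h2.congr' ?_)
  filter_upwards [eventually_ge_atTop 0] with t ht using h t ht

/-- Uniqueness for the Cauchy problem of `V'' + f(V) = 0` on `[0, T]`. -/
theorem second_order_ode_unique {f V V' W W' : ℝ → ℝ} {b T : ℝ} {L : NNReal}
    (hL : LipschitzOnWith L f (Icc 0 b))
    (hV : ∀ t ∈ Icc 0 T, HasDerivWithinAt V (V' t) (Icc 0 T) t)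
    (hV' : ∀ t ∈ Icc 0 T, HasDerivWithinAt V' (-(f (V t))) (Icc 0 T) t)
    (hVm : ∀ t ∈ Icc 0 T, V t ∈ Icc 0 b)
    (hW : ∀ t ∈ Icc 0 T, HasDerivWithinAt W (W' t) (Icc 0 T) t)
    (hW' : ∀ t ∈ Icc 0 T, HasDerivWithinAt W' (-(f (W t))) (Icc 0 T) t)
    (hWm : ∀ t ∈ Icc 0 T, W t ∈ Icc 0 b)
    (h0 : V 0 = W 0) (h0' : V' 0 = W' 0) :
    ∀ t ∈ Icc 0 T, V t = W t ∧ V' t = W' t := by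
  have hlip : LipschitzOnWith (max 1 L) (fun p : ℝ × ℝ => (p.2, -(f p.1))) (Icc 0 b ×ˢ univ) := by
    refine LipschitzOnWith.of_dist_le_mul fun p hp q hq => ?_
    have h1 := hL.dist_le_mul p.1 hp.1 q.1 hq.1
    have h2 : dist p.1 q.1 ≤ dist p q := by rw [Prod.dist_eq]; exact le_max_left _ _
    have h3 : dist p.2 q.2 ≤ dist p q := by rw [Prod.dist_eq]; exact le_max_right _ _
    rw [Prod.dist_eq, dist_neg_neg]
    push_cast
    refine max_le ?_ ?_
    · calc dist p.2 q.2 ≤ 1 * dist p q := by rw [one_mul]; exact h3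
        _ ≤ _ := by gcongr; exact le_max_left _ _
    · calc dist (f p.1) (f q.1) ≤ L * dist p.1 q.1 := h1
        _ ≤ _ := by gcongr; exact le_max_right _ _
  have hmem : ∀ t ∈ Ico 0 T, Icc 0 T ∈ nhdsWithin t (Ici t) := fun t ht =>
    Filter.mem_of_superset (Icc_mem_nhdsGE ht.2) (Icc_subset_Icc_left ht.1)
  have key : EqOn (fun t => (V t, V' t)) (fun t => (W t, W' t)) (Icc 0 T) :=
    ODE_solution_unique_of_mem_Icc_right (v := fun _ p => (p.2, -(f p.1)))
      (s := fun _ => Icc 0 b ×ˢ univ) (fun _ _ => hlip)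
      (fun t ht => ((hV t ht).prodMk (hV' t ht)).continuousWithinAt)
      (fun t ht => ((hV t (Ico_subset_Icc_self ht)).prodMk
        (hV' t (Ico_subset_Icc_self ht))).mono_of_mem_nhdsWithin (hmem t ht))
      (fun t ht => ⟨hVm t (Ico_subset_Icc_self ht), mem_univ _⟩)
      (fun t ht => ((hW t ht).prodMk (hW' t ht)).continuousWithinAt)
      (fun t ht => ((hW t (Ico_subset_Icc_self ht)).prodMk
        (hW' t (Ico_subset_Icc_self ht))).mono_of_mem_nhdsWithin (hmem t ht))
      (fun t ht => ⟨hWm t (Ico_subset_Icc_self ht), mem_univ _⟩)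
      (by simp only [h0, h0'])
  intro t ht
  exact Prod.mk_inj.1 (key ht)

theorem InRf.energy {f V V' : ℝ → ℝ} (hf : LocLipOn f) (h : InRf f V V') {t : ℝ} (ht : 0 ≤ t) :
    V' t ^ 2 + 2 * Ff f (V t) = V' 0 ^ 2 := by
  obtain ⟨hV, hV', h0, hpos, -⟩ := h
  have hE : ∀ s ∈ Ici (0 : ℝ),
      HasDerivWithinAt (fun s => V' s ^ 2 + 2 * Ff f (V s)) 0 (Ici 0) s := by
    intro s hs
    have h1 := ((hV' s hs).pow 2).add
      (((hf.hasDerivWithinAt_Ff (hpos s hs)).comp s (hV s hs) hpos).const_mul 2)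
    refine h1.congr_deriv ?_
    push_cast
    ring
  rcases ht.eq_or_lt with rfl | ht
  · simp [h0, Ff_zero]
  · obtain ⟨c, -, hc⟩ := exists_sub_eq_mul_of_hasDerivWithinAt_Ici (u' := fun _ => 0) hE le_rfl ht
    simp only [h0, Ff_zero] at hc
    linarith

/-- Two elements of `R_f` with the same initial slope agree. -/
theorem InRf.eqOn {f V V' W W' : ℝ → ℝ} (hf : LocLipOn f) (hV : InRf f V V') (hW : InRf f W W')
    (h0 : V' 0 = W' 0) : EqOn V W (Ici 0) := by
  obtain ⟨hV1, hV2, hV0, hVpos, C, hC⟩ := hV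
  obtain ⟨hW1, hW2, hW0, hWpos, D, hD⟩ := hW
  obtain ⟨L, hL⟩ := hf (max C D)
  intro T hT
  have hsub : Icc 0 T ⊆ Ici (0 : ℝ) := fun t ht => ht.1
  exact (second_order_ode_unique hL (fun t ht => (hV1 t ht.1).mono hsub)
    (fun t ht => (hV2 t ht.1).mono hsub)
    (fun t ht => ⟨hVpos t ht.1, (hC t ht.1).trans (le_max_left _ _)⟩)
    (fun t ht => (hW1 t ht.1).mono hsub) (fun t ht => (hW2 t ht.1).mono hsub)
    (fun t ht => ⟨hWpos t ht.1, (hD t ht.1).trans (le_max_right _ _)⟩)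
    (hV0.trans hW0.symm) h0 T ⟨hT, le_rfl⟩).1

/-- By reflection about a critical point, the slope at the origin vanishes as soon as the slope
vanishes anywhere. -/
theorem InRf.deriv_zero_eq_zero {f V V' : ℝ → ℝ} (hf : LocLipOn f) (h : InRf f V V') {a : ℝ}
    (ha : 0 ≤ a) (hVa : V' a = 0) : V' 0 = 0 := by
  rcases ha.eq_or_lt with rfl | ha
  · exact hVa
  obtain ⟨hV, hV', h0, hpos, C, hC⟩ := h
  obtain ⟨L, hL⟩ := hf C
  have hplus : MapsTo (fun t => a + t) (Icc 0 a) (Ici 0) := fun t ht =>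
    mem_Ici.2 (add_nonneg ha.le ht.1)
  have hminus : MapsTo (fun t => a - t) (Icc 0 a) (Ici 0) := fun t ht =>
    mem_Ici.2 (sub_nonneg.2 ht.2)
  have dplus : ∀ t, HasDerivWithinAt (fun t : ℝ => a + t) 1 (Icc 0 a) t := fun t =>
    ((hasDerivAt_id t).const_add a).hasDerivWithinAt
  have dminus : ∀ t, HasDerivWithinAt (fun t : ℝ => a - t) (-1) (Icc 0 a) t := fun t =>
    ((hasDerivAt_id t).const_sub a).hasDerivWithinAt
  have key := second_order_ode_unique (V := fun t => V (a + t)) (V' := fun t => V' (a + t))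
    (W := fun t => V (a - t)) (W' := fun t => -V' (a - t)) (T := a) hL
    (fun t ht => ((hV _ (hplus ht)).comp t (dplus t) hplus).congr_deriv (by ring))
    (fun t ht => ((hV' _ (hplus ht)).comp t (dplus t) hplus).congr_deriv (by ring))
    (fun t ht => ⟨hpos _ (hplus ht), hC _ (hplus ht)⟩)
    (fun t ht => ((hV _ (hminus ht)).comp t (dminus t) hminus).congr_deriv (by ring))
    (fun t ht => ((hV' _ (hminus ht)).comp t (dminus t) hminus).neg.congr_deriv (by ring))
    (fun t ht => ⟨hpos _ (hminus ht), hC _ (hminus ht)⟩)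
    (by simp) (by simp [hVa]) a ⟨ha.le, le_rfl⟩
  simp only [sub_self, h0] at key
  have hmin : IsLocalMin V (a + a) := by
    filter_upwards [Ici_mem_nhds (show (0 : ℝ) < a + a by linarith)] with t ht
    rw [key.1]
    exact hpos t ht
  have hz := hmin.hasDerivAt_eq_zero
    ((hV (a + a) (mem_Ici.2 (by linarith))).hasDerivAt (Ici_mem_nhds (by linarith)))
  linarith [key.2]

theorem InRf.deriv_zero_nonneg {f V V' : ℝ → ℝ} (h : InRf f V V') : 0 ≤ V' 0 := by
  obtain ⟨hV, -, h0, hpos, -⟩ := h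
  have h1 := (hasDerivWithinAt_iff_tendsto_slope.1 (hV 0 self_mem_Ici))
  rw [Ici_sdiff_left] at h1
  refine ge_of_tendsto h1 ?_
  filter_upwards [self_mem_nhdsWithin] with t ht
  have ht : (0 : ℝ) < t := ht
  rw [slope_def_field, h0, sub_zero, sub_zero]
  exact div_nonneg (hpos t ht.le) ht.le

theorem InRf.f_zero_eq_zero {f V V' : ℝ → ℝ} (hf : LocLipOn f) (hf0 : 0 ≤ f 0) (h : InRf f V V')
    (hd : V' 0 = 0) : f 0 = 0 := by
  obtain ⟨hV, hV', h0, hpos, -⟩ := h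
  by_contra hne
  have hlt : 0 < f 0 := lt_of_le_of_ne hf0 (Ne.symm hne)
  have hc : ContinuousWithinAt (fun t => f (V t)) (Ici 0) 0 :=
    (hf.continuousOn (V 0) (hpos 0 le_rfl)).comp (hV 0 self_mem_Ici).continuousWithinAt hpos
  have hev : ∀ᶠ t in nhdsWithin (0 : ℝ) (Ici 0), 0 < f (V t) :=
    hc.eventually (lt_mem_nhds (by simpa only [h0] using hlt))
  obtain ⟨δ, hδ, hsub⟩ := (mem_nhdsGE_iff_exists_Ico_subset).1 hev
  have hδ : (0 : ℝ) < δ := hδ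
  obtain ⟨c, hcm, h1⟩ := exists_sub_eq_mul_of_hasDerivWithinAt_Ici hV le_rfl (half_pos hδ)
  obtain ⟨e, hem, h2⟩ := exists_sub_eq_mul_of_hasDerivWithinAt_Ici hV' le_rfl hcm.1
  have h3 : 0 < f (V e) := hsub ⟨hem.1.le, by linarith [hem.2, hcm.2]⟩
  have h4 : V' c < 0 := by
    have := mul_pos h3 hcm.1
    linarith
  have h5 := mul_pos_of_neg_of_neg h4 (show -(δ / 2) < 0 by linarith)
  have h6 := hpos (δ / 2) (by linarith)
  linarith

theorem inRf_zero {f : ℝ → ℝ} (hf : f 0 = 0) : InRf f (fun _ => 0) (fun _ => 0) :=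
  ⟨fun t _ => hasDerivWithinAt_const t _ _,
    fun t _ => by simpa [hf] using hasDerivWithinAt_const t (Ici (0 : ℝ)) (0 : ℝ),
    rfl, fun _ _ => le_rfl, 0, fun _ _ => le_rfl⟩

theorem zero_mem_Zf {f : ℝ → ℝ} (hf : f 0 = 0) : (0 : ℝ) ∈ Zf f :=
  ⟨le_rfl, hf, fun _ h1 h2 => absurd h2 h1.not_gt⟩

theorem InRf.exists_limit {f V V' : ℝ → ℝ} (hf : LocLipOn f) (hf0 : 0 ≤ f 0) (h : InRf f V V') :
    ∃ z₀ : ℝ, Tendsto V atTop (nhds z₀) ∧ z₀ ∈ Zf f ∧ V' 0 ^ 2 = 2 * Ff f z₀ := by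
  rcases h.deriv_zero_nonneg.eq_or_lt with hd | hd
  · have hfz := h.f_zero_eq_zero hf hf0 hd.symm
    refine ⟨0, ?_, zero_mem_Zf hfz, by rw [Ff_zero, ← hd]; norm_num⟩
    refine tendsto_const_nhds.congr' ?_
    filter_upwards [eventually_ge_atTop 0] with t ht
    exact (h.eqOn hf (inRf_zero hfz) hd.symm ht).symm
  have hpos' : ∀ t, 0 ≤ t → 0 < V' t := by
    intro t ht
    by_contra! hle
    have hcont : ContinuousOn V' (Icc 0 t) := fun s hs =>
      (h.2.1 s hs.1).continuousWithinAt.mono fun r hr => hr.1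
    obtain ⟨a, ha, hVa⟩ := intermediate_value_Icc' ht hcont ⟨hle, hd.le⟩
    exact hd.ne' (h.deriv_zero_eq_zero hf ha.1 hVa)
  have henergy := fun t ht => h.energy hf (t := t) ht
  obtain ⟨hV, hV', h0, hpos, C, hC⟩ := h
  have hcont : ContinuousOn V (Ici 0) := fun s hs => (hV s hs).continuousWithinAt
  have hmono : StrictMonoOn V (Ici 0) := by
    intro a ha b hb hab
    obtain ⟨c, hc, h1⟩ := exists_sub_eq_mul_of_hasDerivWithinAt_Ici hV ha hab
    have := mul_pos (hpos' c (le_trans ha hc.1.le)) (sub_pos.2 hab)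
    linarith
  obtain ⟨z₀, hz⟩ : ∃ z₀, Tendsto V atTop (nhds z₀) := by
    have hm : Monotone fun t => V (max t 0) := fun a b hab =>
      hmono.monotoneOn (mem_Ici.2 (le_max_right _ _)) (mem_Ici.2 (le_max_right _ _)) (max_le_max_right 0 hab)
    refine ⟨_, (tendsto_atTop_ciSup hm ⟨C, ?_⟩).congr' ?_⟩
    · rintro _ ⟨t, rfl⟩
      exact hC _ (le_max_right _ _)
    · filter_upwards [eventually_ge_atTop 0] with t ht
      rw [max_eq_left ht]
  have hz0 : 0 ≤ z₀ := ge_of_tendsto hz ((eventually_ge_atTop 0).mono hpos)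
  have hzin : Tendsto V atTop (nhdsWithin z₀ (Ici 0)) :=
    tendsto_nhdsWithin_iff.2 ⟨hz, (eventually_ge_atTop 0).mono hpos⟩
  have hF : Tendsto (fun t => Ff f (V t)) atTop (nhds (Ff f z₀)) :=
    (hf.hasDerivWithinAt_Ff hz0).continuousWithinAt.tendsto.comp hzin
  have hfl : Tendsto (fun t => -f (V t)) atTop (nhds (-f z₀)) :=
    ((hf.continuousOn z₀ hz0).tendsto.comp hzin).neg
  have hV'lim : Tendsto V' atTop (nhds √(V' 0 ^ 2 - 2 * Ff f z₀)) := by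
    refine (((hF.const_mul 2).const_sub (V' 0 ^ 2)).sqrt).congr' ?_
    filter_upwards [eventually_ge_atTop 0] with t ht
    rw [← henergy t ht, add_sub_cancel_right, Real.sqrt_sq (hpos' t ht).le]
  have hsq : Tendsto (fun t => V' t ^ 2) atTop (nhds (V' 0 ^ 2 - 2 * Ff f z₀)) := by
    refine ((hF.const_mul 2).const_sub (V' 0 ^ 2)).congr' ?_
    filter_upwards [eventually_ge_atTop 0] with t ht
    rw [← henergy t ht, add_sub_cancel_right]
  have hl0 := eq_zero_of_tendsto_of_tendsto_deriv hV hz hV'lim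
  have hE : V' 0 ^ 2 = 2 * Ff f z₀ := by
    have := tendsto_nhds_unique hsq (hV'lim.pow 2)
    rw [hl0] at this
    linarith
  refine ⟨z₀, hz, ⟨hz0, ?_, ?_⟩, hE⟩
  · exact neg_eq_zero.1 (eq_zero_of_tendsto_of_tendsto_deriv hV' hV'lim hfl)
  · intro w hw0 hwz
    obtain ⟨T, hT0, hwT⟩ := ((eventually_ge_atTop 0).and (hz.eventually (lt_mem_nhds hwz))).exists
    obtain ⟨t, ht, rfl⟩ := intermediate_value_Icc hT0 (hcont.mono fun s hs => hs.1)
      (show w ∈ Icc (V 0) (V T) from ⟨by rwa [h0], hwT.le⟩)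
    have h1 := henergy t ht.1
    have h2 := pow_pos (hpos' t ht.1) 2
    linarith

/-- A `C¹` function whose derivative is bounded below by a positive constant is an increasing
bijection with differentiable inverse. -/
theorem exists_inverse_of_deriv_ge {h : ℝ → ℝ} {c : ℝ} (hh : Continuous h) (hc : 0 < c)
    (hge : ∀ x, c ≤ h x) (a : ℝ) :
    ∃ σ : ℝ → ℝ, StrictMono σ ∧ σ 0 = a ∧ Tendsto σ atTop atTop ∧
      ∀ t, HasDerivAt σ (h (σ t))⁻¹ t := by
  set H : ℝ → ℝ := fun x => ∫ s in a..x, h s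
  have hd : ∀ x, HasDerivAt H (h x) x := fun x => (hh.integral_hasStrictDerivAt a x).hasDerivAt
  have hpos : ∀ x, 0 < h x := fun x => hc.trans_le (hge x)
  have hmono : StrictMono H := strictMono_of_hasDerivAt_pos hd hpos
  have hm : Monotone fun x => H x - c * x := by
    have hd' : ∀ x, HasDerivAt (fun x => H x - c * x) (h x - c * 1) x := fun x =>
      (hd x).sub ((hasDerivAt_id x).const_mul c)
    refine monotone_of_deriv_nonneg (fun x => (hd' x).differentiableAt) fun x => ?_
    rw [(hd' x).deriv]
    linarith [hge x]
  have htop : Tendsto H atTop atTop := by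
    refine tendsto_atTop_mono' atTop ?_ (tendsto_atTop_add_const_right atTop (H 0)
      (tendsto_id.const_mul_atTop hc))
    filter_upwards [eventually_ge_atTop 0] with x hx
    have := hm hx
    simp only [mul_zero, sub_zero, id] at this ⊢
    linarith
  have hbot : Tendsto H atBot atBot := by
    refine tendsto_atBot_mono' atBot ?_ (tendsto_atBot_add_const_right atBot (H 0)
      (tendsto_id.const_mul_atBot hc))
    filter_upwards [eventually_le_atBot 0] with x hx
    have := hm hx
    simp only [mul_zero, sub_zero, id] at this ⊢
    linarith
  have hcont : Continuous H := continuous_iff_continuousAt.2 fun x => (hd x).continuousAt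
  set e := hmono.orderIsoOfSurjective H (hcont.surjective htop hbot)
  have hHe : ∀ t, H (e.symm t) = t := fun t => e.apply_symm_apply t
  refine ⟨e.symm, e.symm.strictMono, ?_, e.symm.tendsto_atTop, fun t => ?_⟩
  · refine hmono.injective ?_
    rw [hHe]
    exact intervalIntegral.integral_same.symm
  · exact HasDerivAt.of_local_left_inverse e.symm.continuous.continuousAt (hd _) (hpos _).ne'
      (Filter.Eventually.of_forall hHe)

theorem exists_inRf_of_mem_Zf {f : ℝ → ℝ} (hf : LocLipOn f) {z₀ : ℝ} (hz : z₀ ∈ Zf f) :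
    ∃ V V' : ℝ → ℝ, InRf f V V' ∧ Tendsto V atTop (nhds z₀) := by
  obtain ⟨hz0, hfz, hlt⟩ := hz
  rcases hz0.eq_or_lt with rfl | hz0
  · exact ⟨_, _, inRf_zero hfz, tendsto_const_nhds⟩
  obtain ⟨L, hL⟩ := hf z₀
  have hbound : ∀ s, 0 ≤ s → s < z₀ → Ff f z₀ - Ff f s ≤ L * (z₀ - s) ^ 2 := by
    intro s hs hsz
    obtain ⟨c, hc, h1⟩ := exists_sub_eq_mul_of_hasDerivWithinAt_Ici
      (fun t ht => hf.hasDerivWithinAt_Ff ht) hs hsz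
    have h2 := hL.dist_le_mul c ⟨hs.trans hc.1.le, hc.2.le⟩ z₀ ⟨hz0.le, le_rfl⟩
    rw [hfz, Real.dist_eq, Real.dist_eq, sub_zero, abs_sub_comm c, abs_of_pos (sub_pos.2 hc.2)]
      at h2
    have h3 : f c ≤ L * (z₀ - s) := (le_abs_self _).trans
      (h2.trans (mul_le_mul_of_nonneg_left (by linarith [hc.1]) L.coe_nonneg))
    rw [h1]
    nlinarith [mul_le_mul_of_nonneg_right h3 (sub_pos.2 hsz).le]
  set p : ℝ → ℝ := fun s => √(2 * (Ff f z₀ - Ff f (max s 0))) with hp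
  have hpcont : Continuous p := by
    have hFc : Continuous fun s => Ff f (max s 0) :=
      ContinuousOn.comp_continuous (s := Ici 0)
        (fun s hs => (hf.hasDerivWithinAt_Ff hs).continuousWithinAt)
        (by fun_prop) fun y => le_max_right y 0
    fun_prop
  have hgap : ∀ s, s < z₀ → 0 < 2 * (Ff f z₀ - Ff f (max s 0)) := fun s hs =>
    mul_pos two_pos (sub_pos.2 (hlt _ (le_max_right _ _) (max_lt hs hz0)))
  have hppos : ∀ s, s < z₀ → 0 < p s := fun s hs => Real.sqrt_pos.2 (hgap s hs)
  obtain ⟨C, hC, hpC⟩ : ∃ C : ℝ, 0 < C ∧ ∀ s, s < z₀ → p s ≤ C * (z₀ - s) := by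
    refine ⟨√(2 * L) + 1, by positivity, fun s hs => ?_⟩
    have hm : max s 0 < z₀ := max_lt hs hz0
    calc p s ≤ √((2 * L) * (z₀ - max s 0) ^ 2) := by
          refine Real.sqrt_le_sqrt ?_
          have := hbound _ (le_max_right s 0) hm
          linarith
      _ = √(2 * L) * (z₀ - max s 0) := by
          rw [Real.sqrt_mul (by positivity), Real.sqrt_sq (sub_pos.2 hm).le]
      _ ≤ (√(2 * L) + 1) * (z₀ - s) := by
          have h1 := le_max_left s 0
          have h2 : 0 ≤ z₀ - s := by linarith
          gcongr
          linarith
  have hexp : ∀ τ : ℝ, z₀ - Real.exp (-τ) < z₀ := fun τ => sub_lt_self _ (Real.exp_pos _)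
  obtain ⟨σ, hσm, hσ0, hσt, hσd⟩ := exists_inverse_of_deriv_ge
    (h := fun τ => Real.exp (-τ) / p (z₀ - Real.exp (-τ))) (c := C⁻¹)
    (Continuous.div (by fun_prop) (by fun_prop) fun τ => (hppos _ (hexp τ)).ne') (inv_pos.2 hC)
    (fun τ => by
      have h1 := hpC _ (hexp τ)
      rw [sub_sub_cancel] at h1
      rw [le_div_iff₀ (hppos _ (hexp τ)), inv_mul_le_iff₀ hC]
      exact h1) (-Real.log z₀)
  set V : ℝ → ℝ := fun t => z₀ - Real.exp (-σ t) with hVdef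
  have hVlt : ∀ t, V t < z₀ := fun t => hexp (σ t)
  have hV0 : V 0 = 0 := by simp [hVdef, hσ0, Real.exp_log hz0]
  have hVpos : ∀ t, 0 ≤ t → 0 ≤ V t := by
    intro t ht
    rw [← hV0]
    have := hσm.monotone ht
    simp only [hVdef]
    gcongr
  have hVd : ∀ t, HasDerivAt V (p (V t)) t := by
    intro t
    refine (((hσd t).neg.exp).const_sub z₀).congr_deriv ?_
    have h1 := (Real.exp_pos (-σ t)).ne'
    have h2 : p (V t) ≠ 0 := (hppos _ (hVlt t)).ne'
    simp only [hVdef, Pi.neg_apply] at h2 ⊢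
    field_simp
  refine ⟨V, fun t => p (V t), ⟨fun t _ => (hVd t).hasDerivWithinAt, fun t ht => ?_, hV0, hVpos,
    z₀, fun t _ => (hVlt t).le⟩, ?_⟩
  · have hmax : ∀ s ∈ Ici (0 : ℝ), p (V s) = √(2 * (Ff f z₀ - Ff f (V s))) := fun s hs => by
      simp only [hp, max_eq_left (hVpos s hs)]
    have hne : p (V t) ≠ 0 := (hppos _ (hVlt t)).ne'
    have hg := (hgap _ (hVlt t)).ne'
    rw [max_eq_left (hVpos t ht)] at hg
    have hd := ((((hf.hasDerivWithinAt_Ff (hVpos t ht)).comp t (hVd t).hasDerivWithinAt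
      hVpos).const_sub (Ff f z₀)).const_mul 2).sqrt hg
    refine (hd.congr hmax (hmax t ht)).congr_deriv ?_
    simp only [Function.comp_apply]
    rw [← hmax t ht]
    field_simp
  · have h1 : Tendsto (fun t => Real.exp (-σ t)) atTop (nhds 0) :=
      Real.tendsto_exp_neg_atTop_nhds_zero.comp hσt
    simpa using h1.const_sub z₀

/-- Lemma 4.1 (main part): for `f` locally Lipschitz on `[0,∞)` with `f(0) ≥ 0`, every
`V ∈ R_f` has a finite limit `z₀(V)` at `+∞`, this limit lies in `Z_f` and
`V'(0)² = 2F(z₀(V))`; moreover `V ↦ z₀(V)` is a bijection from `R_f` onto `Z_f`. -/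
theorem stmt_9
    (f : ℝ → ℝ) (hf_lip : LocLipOn f) (hf0 : 0 ≤ f 0) :
    (∀ V V' : ℝ → ℝ, InRf f V V' →
        ∃ z₀ : ℝ, Filter.Tendsto V Filter.atTop (nhds z₀) ∧ z₀ ∈ Zf f ∧
          V' 0 ^ 2 = 2 * Ff f z₀) ∧
    (∀ V V' W W' : ℝ → ℝ, ∀ z₀ : ℝ, InRf f V V' → InRf f W W' →
        Filter.Tendsto V Filter.atTop (nhds z₀) →
        Filter.Tendsto W Filter.atTop (nhds z₀) →
        Set.EqOn V W (Set.Ici 0)) ∧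
    (∀ z₀ ∈ Zf f, ∃ V V' : ℝ → ℝ, InRf f V V' ∧
        Filter.Tendsto V Filter.atTop (nhds z₀)) := by
  refine ⟨fun V V' h => h.exists_limit hf_lip hf0, ?_,
    fun z₀ hz => exists_inRf_of_mem_Zf hf_lip hz⟩
  intro V V' W W' z₀ hV hW hVz hWz
  obtain ⟨v, hv, -, hv2⟩ := hV.exists_limit hf_lip hf0
  obtain ⟨w, hw, -, hw2⟩ := hW.exists_limit hf_lip hf0
  obtain rfl := tendsto_nhds_unique hVz hv
  obtain rfl := tendsto_nhds_unique hWz hw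
  exact hV.eqOn hf_lip hW
    ((sq_eq_sq₀ hV.deriv_zero_nonneg hW.deriv_zero_nonneg).1 (hv2.trans hw2.symm))
end
end

section
/- Let f : [0,+∞) → ℝ be locally Lipschitz-continuous with f(0) ≥ 0. Then the set Z_f is a totally disconnected subset of ℝ, i.e., Z_f contains no nondegenerate interval. -/
open Set Filter

noncomputable section

/-- Lemma 4.1 (total disconnectedness of `Z_f`): for `f` locally Lipschitz on `[0,∞)` with
`f(0) ≥ 0`, the set `Z_f` contains no nondegenerate interval. -/
theorem stmt_10
    (f : ℝ → ℝ) (hf_lip : LocLipOn f) (hf0 : 0 ≤ f 0) :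
    ∀ a b : ℝ, a < b → ¬ (Set.Icc a b ⊆ Zf f) := by
  intro a b hab hsub
  have ha : 0 ≤ a := (hsub (left_mem_Icc.2 hab.le)).1
  obtain ⟨-, -, hmax⟩ := hsub (right_mem_Icc.2 hab.le)
  obtain ⟨L, hL⟩ := hf_lip b
  have hint : ∀ x y, 0 ≤ x → x ≤ y → y ≤ b → IntervalIntegrable f MeasureTheory.volume x y :=
    fun x y hx hxy hy =>
      (hL.continuousOn.mono (Icc_subset_Icc hx hy)).intervalIntegrable_of_Icc hxy
  have hzero : ∫ σ in a..b, f σ = 0 := by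
    have h : EqOn f (fun _ => 0) (uIcc a b) := fun x hx =>
      (hsub (by rwa [uIcc_of_le hab.le] at hx)).2.1
    simp [intervalIntegral.integral_congr h]
  have hadd : Ff f a + ∫ σ in a..b, f σ = Ff f b :=
    intervalIntegral.integral_add_adjacent_intervals
      (hint 0 a le_rfl ha hab.le) (hint a b ha hab.le le_rfl)
  linarith [hmax a ha hab]
end
end

section
/- Let f satisfy (H1). Then there exists a unique V ∈ C²([0,+∞)) satisfying V''(ξ) + f(V(ξ)) = 0 for all ξ ≥ 0, V(0) = 0, 0 < V(ξ) < μ for all ξ > 0, and V(ξ) → μ as ξ → +∞. Moreover V'(ξ) > 0 for all ξ ≥ 0. -/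
open Set Filter

noncomputable section

/-- The potential difference `∫_v^μ h`. -/
def potentialGap (h : ℝ → ℝ) (μ v : ℝ) : ℝ := ∫ s in v..μ, h s

/-- The time needed by the solution of `v' = √(2 ∫_v^μ h)` to travel from `0` to `v`. -/
def travelTime (h : ℝ → ℝ) (μ v : ℝ) : ℝ :=
  ∫ s in (0:ℝ)..v, (√(2 * potentialGap h μ s))⁻¹

section Potential

variable {h : ℝ → ℝ} {μ : ℝ}

lemma hasDerivAt_potentialGap (hc : Continuous h) (v : ℝ) :
    HasDerivAt (potentialGap h μ) (-h v) v :=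
  intervalIntegral.integral_hasDerivAt_left (hc.intervalIntegrable _ _)
    (hc.stronglyMeasurableAtFilter _ _) hc.continuousAt

lemma continuous_potentialGap (hc : Continuous h) : Continuous (potentialGap h μ) :=
  continuous_iff_continuousAt.2 fun v => (hasDerivAt_potentialGap hc v).continuousAt

lemma potentialGap_self : potentialGap h μ μ = 0 := intervalIntegral.integral_same

lemma antitone_potentialGap (hc : Continuous h) (h0 : ∀ s, 0 ≤ h s) :
    Antitone (potentialGap h μ) :=
  antitone_of_hasDerivAt_nonpos (hasDerivAt_potentialGap hc) fun v => by simpa using h0 v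

lemma potentialGap_pos (hc : Continuous h) (h0 : ∀ s, 0 ≤ h s) (hμ : 0 < μ)
    (hpos : ∀ s, 0 < s → s < μ → 0 < h s) {v : ℝ} (hv : v < μ) : 0 < potentialGap h μ v := by
  have h1 : max v 0 < μ := max_lt hv hμ
  have h2 : 0 < potentialGap h μ (max v 0) :=
    intervalIntegral.intervalIntegral_pos_of_pos_on (hc.intervalIntegrable _ _)
      (fun s hs => hpos s ((le_max_right _ _).trans_lt hs.1) hs.2) h1
  exact h2.trans_le (antitone_potentialGap hc h0 (le_max_left _ _))

lemma potentialGap_le (hc : Continuous h) {L : ℝ} (hL : 0 ≤ L)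
    (hlin : ∀ s, 0 ≤ s → s ≤ μ → h s ≤ L * (μ - s)) {v : ℝ} (hv0 : 0 ≤ v) (hv : v ≤ μ) :
    potentialGap h μ v ≤ L * (μ - v) ^ 2 := by
  have h1 : potentialGap h μ v ≤ ∫ _ in v..μ, L * (μ - v) :=
    intervalIntegral.integral_mono_on hv (hc.intervalIntegrable _ _)
      intervalIntegrable_const fun s hs =>
        (hlin s (hv0.trans hs.1) hs.2).trans
          (mul_le_mul_of_nonneg_left (by linarith [hs.1]) hL)
  refine h1.trans_eq ?_
  rw [intervalIntegral.integral_const, smul_eq_mul]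
  ring

lemma sqrt_potentialGap_pos (hc : Continuous h) (h0 : ∀ s, 0 ≤ h s) (hμ : 0 < μ)
    (hpos : ∀ s, 0 < s → s < μ → 0 < h s) {v : ℝ} (hv : v < μ) :
    0 < √(2 * potentialGap h μ v) :=
  Real.sqrt_pos.2 (mul_pos two_pos (potentialGap_pos hc h0 hμ hpos hv))

lemma hasDerivAt_travelTime (hc : Continuous h) (h0 : ∀ s, 0 ≤ h s) (hμ : 0 < μ)
    (hpos : ∀ s, 0 < s → s < μ → 0 < h s) {v : ℝ} (hv : v < μ) :
    HasDerivAt (travelTime h μ) (√(2 * potentialGap h μ v))⁻¹ v := by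
  have hs : Continuous fun s => √(2 * potentialGap h μ s) :=
    (continuous_const.mul (continuous_potentialGap hc)).sqrt
  have hat : ∀ s, s < μ → ContinuousAt (fun s => (√(2 * potentialGap h μ s))⁻¹) s := fun s hsμ =>
    hs.continuousAt.inv₀ (sqrt_potentialGap_pos hc h0 hμ hpos hsμ).ne'
  refine intervalIntegral.integral_hasDerivAt_right ?_ ?_ (hat v hv)
  · refine ContinuousOn.intervalIntegrable fun s hsv => (hat s ?_).continuousWithinAt
    exact hsv.2.trans_lt (max_lt hμ hv)
  · exact hs.measurable.inv.stronglyMeasurable.stronglyMeasurableAtFilter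

lemma strictMonoOn_travelTime (hc : Continuous h) (h0 : ∀ s, 0 ≤ h s) (hμ : 0 < μ)
    (hpos : ∀ s, 0 < s → s < μ → 0 < h s) : StrictMonoOn (travelTime h μ) (Iio μ) := by
  refine strictMonoOn_of_hasDerivWithinAt_pos (convex_Iio μ)
    (f' := fun v => (√(2 * potentialGap h μ v))⁻¹)
    (fun v hv => (hasDerivAt_travelTime hc h0 hμ hpos hv).continuousAt.continuousWithinAt) ?_ ?_
  · intro v hv
    rw [interior_Iio] at hv
    exact (hasDerivAt_travelTime hc h0 hμ hpos hv).hasDerivWithinAt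
  · intro v hv
    rw [interior_Iio] at hv
    exact inv_pos.2 (sqrt_potentialGap_pos hc h0 hμ hpos hv)

lemma travelTime_zero : travelTime h μ 0 = 0 := intervalIntegral.integral_same

/-- A linear bound for `h` at `μ` makes the travel time to `μ` infinite. -/
lemma exists_lt_travelTime (hc : Continuous h) (h0 : ∀ s, 0 ≤ h s) (hμ : 0 < μ)
    (hpos : ∀ s, 0 < s → s < μ → 0 < h s) {L : ℝ} (hL : 0 < L)
    (hlin : ∀ s, 0 ≤ s → s ≤ μ → h s ≤ L * (μ - s)) (ξ : ℝ) :
    ∃ v, 0 ≤ v ∧ v < μ ∧ ξ < travelTime h μ v := by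
  set K := √(2 * L) with hK
  have hKpos : 0 < K := Real.sqrt_pos.2 (by positivity)
  have hmono : MonotoneOn (fun v => travelTime h μ v + K⁻¹ * Real.log (μ - v)) (Ico 0 μ) := by
    have hder : ∀ v, v < μ →
        HasDerivAt (fun v => travelTime h μ v + K⁻¹ * Real.log (μ - v))
          ((√(2 * potentialGap h μ v))⁻¹ + K⁻¹ * (-1 / (μ - v))) v := fun v hv =>
      (hasDerivAt_travelTime hc h0 hμ hpos hv).add
        ((((hasDerivAt_id v).const_sub μ).log (sub_pos.2 hv).ne').const_mul _)
    refine monotoneOn_of_hasDerivWithinAt_nonneg (convex_Ico 0 μ)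
      (fun v hv => (hder v hv.2).continuousAt.continuousWithinAt)
      (f' := fun v => (√(2 * potentialGap h μ v))⁻¹ + K⁻¹ * (-1 / (μ - v))) ?_ ?_
    · intro v hv
      exact (hder v (interior_subset hv).2).hasDerivWithinAt
    · intro v hv
      have hv' := interior_subset hv
      have h1 : 0 < μ - v := sub_pos.2 hv'.2
      have h2 : √(2 * potentialGap h μ v) ≤ K * (μ - v) := by
        rw [← Real.sqrt_sq h1.le, hK, ← Real.sqrt_mul (by positivity)]
        refine Real.sqrt_le_sqrt ?_
        have := potentialGap_le hc hL.le hlin hv'.1 hv'.2.le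
        linarith
      have h3 := inv_anti₀ (sqrt_potentialGap_pos hc h0 hμ hpos hv'.2) h2
      rw [mul_inv] at h3
      have h4 : K⁻¹ * (-1 / (μ - v)) = -(K⁻¹ * (μ - v)⁻¹) := by ring
      rw [h4]
      linarith
  obtain ⟨ε, hε0, hεμ, hε⟩ : ∃ ε, 0 < ε ∧ ε ≤ μ ∧ Real.log ε < Real.log μ - K * ξ := by
    refine ⟨min μ (Real.exp (Real.log μ - K * ξ - 1)), lt_min hμ (Real.exp_pos _),
      min_le_left _ _, ?_⟩
    have := Real.log_le_log (lt_min hμ (Real.exp_pos (Real.log μ - K * ξ - 1))) (min_le_right _ _)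
    rw [Real.log_exp] at this
    linarith
  refine ⟨μ - ε, by linarith, by linarith, ?_⟩
  have := hmono ⟨le_rfl, hμ⟩ (⟨by linarith, by linarith⟩ : μ - ε ∈ Ico 0 μ) (by linarith)
  simp only [travelTime_zero, sub_zero, sub_sub_cancel, zero_add] at this
  have h5 : K⁻¹ * Real.log ε < K⁻¹ * (Real.log μ - K * ξ) :=
    mul_lt_mul_of_pos_left hε (inv_pos.2 hKpos)
  rw [mul_sub, inv_mul_cancel_left₀ hKpos.ne'] at h5
  linarith

/-- Inverting the travel time yields a profile. -/
lemma exists_isProfile (hc : Continuous h) (h0 : ∀ s, 0 ≤ h s) (hμ : 0 < μ)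
    (hpos : ∀ s, 0 < s → s < μ → 0 < h s) {L : ℝ} (hL : 0 < L)
    (hlin : ∀ s, 0 ≤ s → s ≤ μ → h s ≤ L * (μ - s)) :
    ∃ V V' : ℝ → ℝ, IsProfile h μ V V' := by
  set T := travelTime h μ with hT
  have hTd : ∀ v, v < μ → HasDerivAt T (√(2 * potentialGap h μ v))⁻¹ v := fun v hv =>
    hasDerivAt_travelTime hc h0 hμ hpos hv
  have hTm : StrictMonoOn T (Iio μ) := strictMonoOn_travelTime hc h0 hμ hpos
  have hT0 : T 0 = 0 := travelTime_zero
  have hneg : T (-1) < 0 := by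
    rw [← hT0]; exact hTm (show (-1:ℝ) < μ by linarith) hμ (by norm_num)
  have hex : ∀ ξ, ∃ v, T (-1) < ξ → -1 < v ∧ v < μ ∧ T v = ξ := by
    intro ξ
    by_cases hξ : T (-1) < ξ
    · obtain ⟨w, hw0, hwμ, hw⟩ := exists_lt_travelTime hc h0 hμ hpos hL hlin ξ
      obtain ⟨v, hv, hvξ⟩ := intermediate_value_Ioo (f := T) (show (-1:ℝ) ≤ w by linarith)
        (fun x hx => (hTd x (hx.2.trans_lt hwμ)).continuousAt.continuousWithinAt) ⟨hξ, hw⟩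
      exact ⟨v, fun _ => ⟨hv.1, hv.2.trans hwμ, hvξ⟩⟩
    · exact ⟨0, fun hξ' => absurd hξ' hξ⟩
  choose V hV using hex
  have hVm : StrictMonoOn V (Ioi (T (-1))) := by
    intro a ha b hb hab
    obtain ⟨-, ha2, ha3⟩ := hV a ha
    obtain ⟨-, hb2, hb3⟩ := hV b hb
    rw [← hTm.lt_iff_lt ha2 hb2, ha3, hb3]
    exact hab
  have hVT : ∀ v, -1 < v → v < μ → T (-1) < T v ∧ V (T v) = v := by
    intro v hv1 hv2
    have h1 : T (-1) < T v := hTm (show (-1:ℝ) < μ by linarith) hv2 hv1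
    obtain ⟨-, h2, h3⟩ := hV _ h1
    exact ⟨h1, hTm.injOn h2 hv2 h3⟩
  have hV0 : V 0 = 0 := by
    have := (hVT 0 (by norm_num) hμ).2
    rwa [hT0] at this
  have hVc : ∀ ξ, T (-1) < ξ → ContinuousAt V ξ := by
    intro ξ hξ
    obtain ⟨h1, h2, -⟩ := hV ξ hξ
    refine hVm.continuousAt_of_image_mem_nhds (Ioi_mem_nhds hξ) ?_
    refine mem_of_superset (Ioo_mem_nhds h1 h2) fun v hv => ?_
    exact ⟨T v, (hVT v hv.1 hv.2).1, (hVT v hv.1 hv.2).2⟩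
  have hVd : ∀ ξ, T (-1) < ξ → HasDerivAt V (√(2 * potentialGap h μ (V ξ))) ξ := by
    intro ξ hξ
    obtain ⟨-, h2, -⟩ := hV ξ hξ
    have := HasDerivAt.of_local_left_inverse (hVc ξ hξ) (hTd (V ξ) h2)
      (inv_pos.2 (sqrt_potentialGap_pos hc h0 hμ hpos h2)).ne'
      (by filter_upwards [Ioi_mem_nhds hξ] with y hy using (hV y hy).2.2)
    rwa [inv_inv] at this
  refine ⟨V, fun ξ => √(2 * potentialGap h μ (V ξ)), ?_, ?_, hV0, ?_, ?_⟩
  · exact fun ξ hξ => (hVd ξ (hneg.trans_le hξ)).hasDerivWithinAt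
  · intro ξ hξ
    have hξ' := hneg.trans_le hξ
    have h2 := (hV ξ hξ').2.1
    have hp := potentialGap_pos hc h0 hμ hpos h2
    have hsp := sqrt_potentialGap_pos hc h0 hμ hpos h2
    have h3 : HasDerivAt (fun ξ => √(2 * potentialGap h μ (V ξ))) _ ξ :=
      (((hasDerivAt_potentialGap (μ := μ) hc (V ξ)).comp ξ (hVd ξ hξ')).const_mul 2).sqrt
        (by simpa using hp.ne')
    refine h3.hasDerivWithinAt.congr_deriv ?_
    simp only [Function.comp_apply]
    field_simp
  · intro ξ hξ
    have hξ' := hneg.trans hξ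
    refine ⟨?_, (hV ξ hξ').2.1⟩
    have := hVm (show T (-1) < 0 from hneg) hξ' hξ
    rwa [hV0] at this
  · refine tendsto_order.2 ⟨fun a ha => ?_, fun a ha => ?_⟩
    · have hb : max a 0 < μ := max_lt ha hμ
      have hb' := hVT (max a 0) (by linarith [le_max_right a 0]) hb
      filter_upwards [eventually_gt_atTop (T (max a 0))] with ξ hξ
      have := hVm hb'.1 (hb'.1.trans hξ) hξ
      rw [hb'.2] at this
      exact (le_max_left _ _).trans_lt this
    · filter_upwards [eventually_gt_atTop (T (-1))] with ξ hξ using ((hV ξ hξ).2.1).trans ha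

end Potential

lemma monotoneOn_Ici_of_hasDerivWithinAt {g g' : ℝ → ℝ} {a : ℝ}
    (hg : ∀ x ∈ Ici a, HasDerivWithinAt g (g' x) (Ici a) x) (hg' : ∀ x ∈ Ici a, 0 ≤ g' x) :
    MonotoneOn g (Ici a) :=
  monotoneOn_of_hasDerivWithinAt_nonneg (convex_Ici a) (fun x hx => (hg x hx).continuousWithinAt)
    (fun x hx => (hg x (interior_subset hx)).mono interior_subset)
    fun x hx => hg' x (interior_subset hx)

lemma antitoneOn_Ici_of_hasDerivWithinAt {g g' : ℝ → ℝ} {a : ℝ}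
    (hg : ∀ x ∈ Ici a, HasDerivWithinAt g (g' x) (Ici a) x) (hg' : ∀ x ∈ Ici a, g' x ≤ 0) :
    AntitoneOn g (Ici a) :=
  antitoneOn_of_hasDerivWithinAt_nonpos (convex_Ici a) (fun x hx => (hg x hx).continuousWithinAt)
    (fun x hx => (hg x (interior_subset hx)).mono interior_subset)
    fun x hx => hg' x (interior_subset hx)

lemma eq_of_hasDerivWithinAt_Ici_zero {g : ℝ → ℝ} {a : ℝ}
    (hg : ∀ x ∈ Ici a, HasDerivWithinAt g 0 (Ici a) x) {x : ℝ} (hx : a ≤ x) : g x = g a :=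
  le_antisymm
    (antitoneOn_Ici_of_hasDerivWithinAt hg (fun _ _ => le_rfl) (mem_Ici.2 le_rfl) hx hx)
    (monotoneOn_Ici_of_hasDerivWithinAt hg (fun _ _ => le_rfl) (mem_Ici.2 le_rfl) hx hx)

section Profile

variable {h V V' : ℝ → ℝ} {μ : ℝ}

lemma IsProfile.mem_Ico (hV : IsProfile h μ V V') (hμ : 0 < μ) {ξ : ℝ} (hξ : 0 ≤ ξ) :
    V ξ ∈ Ico 0 μ := by
  obtain ⟨-, -, h3, h4, -⟩ := hV
  rcases hξ.eq_or_lt with rfl | hξ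
  · rw [h3]; exact ⟨le_rfl, hμ⟩
  · exact ⟨(h4 ξ hξ).1.le, (h4 ξ hξ).2⟩

lemma IsProfile.congr {k : ℝ → ℝ} (hV : IsProfile h μ V V') (hμ : 0 < μ)
    (hk : EqOn h k (Ico 0 μ)) : IsProfile k μ V V' := by
  refine ⟨hV.1, fun ξ hξ => ?_, hV.2.2⟩
  rw [← hk (hV.mem_Ico hμ hξ)]
  exact hV.2.1 ξ hξ

lemma IsProfile.deriv_pos (hV : IsProfile h μ V V') (hμ : 0 < μ) (h0 : ∀ s, 0 ≤ h s)
    {ξ : ℝ} (hξ : 0 ≤ ξ) : 0 < V' ξ := by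
  by_contra! hneg
  have hV' : AntitoneOn V' (Ici 0) :=
    antitoneOn_Ici_of_hasDerivWithinAt hV.2.1 fun x _ => neg_nonpos.2 (h0 _)
  have hsub : Ici ξ ⊆ Ici 0 := Ici_subset_Ici.2 hξ
  have hanti : AntitoneOn V (Ici ξ) :=
    antitoneOn_Ici_of_hasDerivWithinAt (fun x hx => (hV.1 x (hsub hx)).mono hsub)
      fun x hx => (hV' hξ (hsub hx) hx).trans hneg
  have hle : μ ≤ V ξ := le_of_tendsto hV.2.2.2.2 <| by
    filter_upwards [eventually_ge_atTop ξ] with x hx using hanti (mem_Ici.2 le_rfl) hx hx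
  exact hle.not_gt (hV.mem_Ico hμ hξ).2

/-- Conservation of energy: a profile solves a first-order equation. -/
lemma IsProfile.sq_deriv_eq (hV : IsProfile h μ V V') (hμ : 0 < μ) (hc : Continuous h)
    (h0 : ∀ s, 0 ≤ h s) {ξ : ℝ} (hξ : 0 ≤ ξ) : V' ξ ^ 2 = 2 * potentialGap h μ (V ξ) := by
  set c := V' 0 ^ 2 - 2 * potentialGap h μ (V 0) with hcdef
  have hcons : ∀ x, 0 ≤ x → V' x ^ 2 - 2 * potentialGap h μ (V x) = c := by
    intro x hx
    refine eq_of_hasDerivWithinAt_Ici_zero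
      (g := fun x => V' x ^ 2 - 2 * potentialGap h μ (V x)) (fun y hy => ?_) hx
    have h1 := ((hV.2.1 y hy).pow 2).sub
      (((hasDerivAt_potentialGap (μ := μ) hc (V y)).comp_hasDerivWithinAt y (hV.1 y hy)).const_mul 2)
    refine h1.congr_deriv ?_
    norm_num
    ring
  have hgap : Tendsto (fun x => potentialGap h μ (V x)) atTop (nhds 0) := by
    have := ((continuous_potentialGap (μ := μ) hc).tendsto μ).comp hV.2.2.2.2
    rwa [potentialGap_self] at this
  have hc0 : 0 ≤ c := by
    have h1 : Tendsto (fun x => c + 2 * potentialGap h μ (V x)) atTop (nhds c) := by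
      simpa using tendsto_const_nhds.add (hgap.const_mul 2)
    refine ge_of_tendsto h1 ?_
    filter_upwards [eventually_ge_atTop 0] with x hx
    linarith [hcons x hx, sq_nonneg (V' x)]
  have hle : ∀ x, 0 ≤ x → √c ≤ V' x := by
    intro x hx
    refine (Real.sqrt_le_left (hV.deriv_pos hμ h0 hx).le).2 ?_
    have h1 := antitone_potentialGap (μ := μ) hc h0 (hV.mem_Ico hμ hx).2.le
    rw [potentialGap_self] at h1
    linarith [hcons x hx]
  have hc1 : √c = 0 := by
    by_contra hne
    have hpos : 0 < √c := (Real.sqrt_nonneg c).lt_of_ne' hne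
    have hmono : MonotoneOn (fun x => V x - √c * x) (Ici 0) :=
      monotoneOn_Ici_of_hasDerivWithinAt
        (fun x hx => (hV.1 x hx).sub ((hasDerivWithinAt_id x _).const_mul (√c)))
        fun x hx => by linarith [hle x hx]
    have hx : 0 ≤ μ / √c := by positivity
    have h1 := hmono (mem_Ici.2 le_rfl) hx hx
    simp only [hV.2.2.1, mul_zero, sub_zero, mul_div_cancel₀ _ hne] at h1
    linarith [(hV.mem_Ico hμ hx).2]
  rw [Real.sqrt_eq_zero hc0] at hc1
  linarith [hcons ξ hξ]

lemma IsProfile.travelTime_eq (hV : IsProfile h μ V V') (hμ : 0 < μ) (hc : Continuous h)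
    (h0 : ∀ s, 0 ≤ h s) (hpos : ∀ s, 0 < s → s < μ → 0 < h s) {ξ : ℝ} (hξ : 0 ≤ ξ) :
    travelTime h μ (V ξ) = ξ := by
  have hd : ∀ x ∈ Ici (0:ℝ),
      HasDerivWithinAt (fun x => travelTime h μ (V x) - x) 0 (Ici 0) x := by
    intro x hx
    have hp := hV.deriv_pos hμ h0 hx
    have h1 := ((hasDerivAt_travelTime hc h0 hμ hpos
      (hV.mem_Ico hμ hx).2).comp_hasDerivWithinAt x (hV.1 x hx)).sub (hasDerivWithinAt_id x _)
    refine h1.congr_deriv ?_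
    rw [← hV.sq_deriv_eq hμ hc h0 hx, Real.sqrt_sq hp.le, inv_mul_cancel₀ hp.ne', sub_self]
  have h2 := eq_of_hasDerivWithinAt_Ici_zero hd hξ
  simp only [hV.2.2.1, travelTime_zero, sub_zero] at h2
  linarith

end Profile

/-- A reaction term satisfying (H1) agrees on `[0, μ]` with a nonnegative continuous function on
`ℝ` which is positive on `(0, μ)` and grows at most linearly away from `μ`. -/
lemma H1.exists_extension {f : ℝ → ℝ} {μ' μ : ℝ} (hf : H1 f μ' μ) :
    ∃ h : ℝ → ℝ, EqOn f h (Icc 0 μ) ∧ Continuous h ∧ (∀ s, 0 ≤ h s) ∧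
      (∀ s, 0 < s → s < μ → 0 < h s) ∧
      ∃ L > 0, ∀ s, 0 ≤ s → s ≤ μ → h s ≤ L * (μ - s) := by
  obtain ⟨hlip, hμ', hμμ', hpos, hnonpos, -, hzero⟩ := hf
  have hμ : 0 < μ := hμ'.trans hμμ'
  obtain ⟨L, hL⟩ := hlip μ
  have hmem : ∀ s : ℝ, max 0 (min s μ) ∈ Icc 0 μ := fun s =>
    ⟨le_max_left _ _, max_le hμ.le (min_le_right _ _)⟩
  have heq : EqOn f (fun s => f (max 0 (min s μ))) (Icc 0 μ) := fun s hs => by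
    simp only [min_eq_left hs.2, max_eq_right hs.1]
  have hfμ : f μ = 0 := by
    refine le_antisymm (hnonpos μ le_rfl) ?_
    have hcont : ContinuousWithinAt f (Ioo 0 μ) μ :=
      (hL.continuousOn μ ⟨hμ.le, le_rfl⟩).mono Ioo_subset_Icc_self
    have : (nhdsWithin μ (Ioo 0 μ)).NeBot := by
      rw [nhdsWithin_Ioo_eq_nhdsLT hμ]; infer_instance
    refine ge_of_tendsto hcont ?_
    filter_upwards [self_mem_nhdsWithin] with s hs using (hpos s hs.1 hs.2).le
  have hf0 : ∀ s ∈ Icc 0 μ, 0 ≤ f s := by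
    rintro s ⟨hs0, hsμ⟩
    rcases hs0.eq_or_lt with rfl | hs0
    · rcases hzero with h | h
      exacts [h.le, h.1.ge]
    rcases hsμ.eq_or_lt with rfl | hsμ
    exacts [hfμ.ge, (hpos s hs0 hsμ).le]
  refine ⟨fun s => f (max 0 (min s μ)), heq,
    hL.continuousOn.comp_continuous (by fun_prop) hmem, fun s => hf0 _ (hmem s), ?_,
    (L : ℝ) + 1, by positivity, ?_⟩
  · intro s hs0 hsμ
    rw [← heq ⟨hs0.le, hsμ.le⟩]
    exact hpos s hs0 hsμ
  · intro s hs0 hsμ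
    rw [← heq ⟨hs0, hsμ⟩]
    have h1 := hL.dist_le_mul s ⟨hs0, hsμ⟩ μ ⟨hμ.le, le_rfl⟩
    rw [Real.dist_eq, Real.dist_eq, hfμ, sub_zero, abs_sub_comm,
      abs_of_nonneg (sub_nonneg.2 hsμ)] at h1
    linarith [le_abs_self (f s)]

/-- Under (H1), there exists a unique `V ∈ C²([0,∞))` with `V'' + f(V) = 0`, `V(0) = 0`,
`0 < V < μ` on `(0,∞)` and `V(+∞) = μ`; moreover `V' > 0` on `[0,∞)`. -/
theorem stmt_11
    (f : ℝ → ℝ) (μ' μ : ℝ) (hf : H1 f μ' μ) :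
    (∃ V V' : ℝ → ℝ, IsProfile f μ V V') ∧
    (∀ V V' W W' : ℝ → ℝ, IsProfile f μ V V' → IsProfile f μ W W' →
        Set.EqOn V W (Set.Ici 0)) ∧
    (∀ V V' : ℝ → ℝ, IsProfile f μ V V' → ∀ ξ, 0 ≤ ξ → 0 < V' ξ) := by
  have hμ : 0 < μ := hf.2.1.trans hf.2.2.1
  obtain ⟨h, heq, hc, h0, hpos, L, hL, hlin⟩ := hf.exists_extension
  have heq' : EqOn f h (Ico 0 μ) := heq.mono Ico_subset_Icc_self
  refine ⟨?_, fun V V' W W' hV hW ξ hξ => ?_, fun V V' hV ξ hξ =>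
    (hV.congr hμ heq').deriv_pos hμ h0 hξ⟩
  · obtain ⟨V, V', hV⟩ := exists_isProfile hc h0 hμ hpos hL hlin
    exact ⟨V, V', hV.congr hμ heq'.symm⟩
  · refine (strictMonoOn_travelTime hc h0 hμ hpos).injOn (hV.mem_Ico hμ hξ).2
      (hW.mem_Ico hμ hξ).2 ?_
    rw [(hV.congr hμ heq').travelTime_eq hμ hc h0 hpos hξ,
      (hW.congr hμ heq').travelTime_eq hμ hc h0 hpos hξ]
end
end

section
/- Let N ≥ 2, let f satisfy (H1), and let u be any bounded nonnegative solution of problem (eq) in the quarter-space Ω with boundary datum u₀ ≢ 0. Then there exist ε > 0 and R > 0 such that u(x) ≥ ε for all x = (x₁,x',x_N) with x₁ ≥ R and x_N ≥ R. -/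
open Set Filter

noncomputable section

/-- Second-order necessary condition at a local minimum. -/
lemma IsLocalMin.deriv_deriv_nonneg {g : ℝ → ℝ} {t : ℝ} (h : IsLocalMin g t)
    (hc : ContinuousAt g t) : 0 ≤ deriv (deriv g) t := by
  by_contra! hneg
  have hmax := isLocalMax_of_deriv_deriv_neg hneg h.deriv_eq_zero hc
  have heq : g =ᶠ[nhds t] fun _ => g t := by
    filter_upwards [h, hmax] with s h1 h2 using le_antisymm h2 h1
  have hd : deriv g =ᶠ[nhds t] fun _ => 0 := by
    simpa using heq.deriv
  rw [hd.deriv_eq] at hneg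
  simp at hneg

lemma pd_pd_eq {N : ℕ} (i : Fin N) (u : (Fin N → ℝ) → ℝ) (x : Fin N → ℝ) :
    pd i (pd i u) x = deriv (deriv fun s => u (Function.update x i s)) (x i) := by
  unfold pd
  simp

/-- If `b` touches `u` from below at `x`, the sum of the pure second derivatives of `b` at `x`
is at most `lap u x`. -/
lemma sum_le_lap_of_isLocalMin_sub {N : ℕ} {u b : (Fin N → ℝ) → ℝ} {x : Fin N → ℝ}
    (hu : ContDiffAt ℝ 2 u x) (hmin : IsLocalMin (fun y => u y - b y) x)
    {b1 : Fin N → ℝ → ℝ} {b2 : Fin N → ℝ}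
    (h1 : ∀ i t, HasDerivAt (fun s => b (Function.update x i s)) (b1 i t) t)
    (h2 : ∀ i, HasDerivAt (b1 i) (b2 i) (x i)) :
    ∑ i, b2 i ≤ lap u x := by
  refine Finset.sum_le_sum fun i _ => ?_
  rw [pd_pd_eq]
  set p : ℝ → ℝ := fun s => u (Function.update x i s) with hp
  set q : ℝ → ℝ := fun s => b (Function.update x i s) with hq
  have hupd : Function.update x i (x i) = x := Function.update_eq_self i x
  have hup : ContDiff ℝ 2 (fun s : ℝ => Function.update x i s) := contDiff_update 2 x i
  have hpc : ContDiffAt ℝ 2 p (x i) := by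
    refine ContDiffAt.comp (x i) (g := u) ?_ hup.contDiffAt
    rwa [hupd]
  have hloc : IsLocalMin (fun s => p s - q s) (x i) := by
    have ht : Tendsto (fun s : ℝ => Function.update x i s) (nhds (x i)) (nhds x) := by
      have := hup.continuous.tendsto (x i)
      rwa [hupd] at this
    filter_upwards [ht.eventually hmin] with s hs
    simpa [hp, hq] using hs
  have hqd : deriv q = b1 i := funext fun t => (h1 i t).deriv
  have hdiff : ∀ᶠ s in nhds (x i), DifferentiableAt ℝ p s := by
    filter_upwards [hpc.eventually (by simp)] with s hs using hs.differentiableAt (by simp)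
  have hd : deriv (fun s => p s - q s) =ᶠ[nhds (x i)] fun s => deriv p s - b1 i s := by
    filter_upwards [hdiff] with s hs
    rw [← hqd]
    exact deriv_fun_sub hs (h1 i s).differentiableAt
  have hp' : DifferentiableAt ℝ (deriv p) (x i) := by
    have h : ContDiffAt ℝ 1 (deriv p) (x i) :=
      (hpc.fderiv_right one_add_one_eq_two.le).clm_apply contDiffAt_const
    exact h.differentiableAt (by simp)
  have hnn := hloc.deriv_deriv_nonneg
    (hpc.continuousAt.sub (h1 i (x i)).continuousAt)
  rw [hd.deriv_eq, deriv_fun_sub hp' (h2 i).differentiableAt, (h2 i).deriv] at hnn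
  linarith

/-- A nonnegative function that is superharmonic where it is less than `μ` and positive at `z` is
positive in the largest Euclidean ball inside any sup-norm ball around `z` in the domain. -/
lemma pos_of_sum_sq_lt {N : ℕ} {u : (Fin N → ℝ) → ℝ} {Ω : Set (Fin N → ℝ)} (hΩ : IsOpen Ω)
    (hu : ContDiffOn ℝ 2 u Ω) (h0 : ∀ x ∈ Ω, 0 ≤ u x) {μ : ℝ} (hμ : 0 < μ)
    (hlap : ∀ x ∈ Ω, u x < μ → lap u x ≤ 0) {z : Fin N → ℝ} {ρ : ℝ} (hρ : 0 < ρ)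
    (hball : Metric.closedBall z ρ ⊆ Ω) (hz : 0 < u z) {x : Fin N → ℝ}
    (hx : ∑ i, (x i - z i) ^ 2 < ρ ^ 2) : 0 < u x := by
  have hzΩ : z ∈ Ω := hball (Metric.mem_closedBall_self hρ.le)
  have huc : ∀ y ∈ Ω, ContDiffAt ℝ 2 u y := fun y hy => hu.contDiffAt (hΩ.mem_nhds hy)
  obtain ⟨r, hr, hru⟩ : ∃ r > 0, ∀ y, dist y z < r → u z / 2 < u y := by
    have := (huc z hzΩ).continuousAt.eventually (lt_mem_nhds (half_lt_self hz))
    rcases Metric.eventually_nhds_iff.1 this with ⟨r, hr, h⟩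
    exact ⟨r, hr, fun y hy => h hy⟩
  obtain ⟨ε, hε, hεz, hεμ⟩ : ∃ ε > 0, ε ≤ u z / 2 ∧ ε ≤ μ :=
    ⟨min (u z / 2) μ, by positivity, min_le_left _ _, min_le_right _ _⟩
  set α : ℝ := (N + 1) / (2 * r ^ 2) with hα
  have hα0 : 0 < α := by positivity
  have hαr : 2 * α * r ^ 2 = N + 1 := by rw [hα]; field_simp
  set Q : (Fin N → ℝ) → ℝ := fun y => ∑ i, (y i - z i) ^ 2 with hQ
  set b : (Fin N → ℝ) → ℝ := fun y => ε * (Real.exp (-α * Q y) - Real.exp (-α * ρ ^ 2)) with hb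
  have hcoord : ∀ y i, (y i - z i) ^ 2 ≤ Q y := fun y i =>
    Finset.single_le_sum (f := fun i => (y i - z i) ^ 2) (fun _ _ => sq_nonneg _)
      (Finset.mem_univ i)
  have hQ0 : ∀ y, 0 ≤ Q y := fun y => Finset.sum_nonneg fun _ _ => sq_nonneg _
  have hin : ∀ y, Q y < ρ ^ 2 → dist y z < ρ := fun y hy => by
    refine (dist_pi_lt_iff hρ).2 fun i => ?_
    rw [Real.dist_eq]
    exact abs_lt_of_sq_lt_sq ((hcoord y i).trans_lt hy) hρ.le
  have hbpos : ∀ y, 0 < b y ↔ Q y < ρ ^ 2 := fun y => by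
    simp only [hb]
    rw [mul_pos_iff_of_pos_left hε, sub_pos, Real.exp_lt_exp]
    constructor <;> intro h <;> nlinarith
  have hbc : Continuous b := by fun_prop
  obtain ⟨w, hw, hwmin⟩ := (isCompact_closedBall z ρ).exists_isMinOn
    (f := fun y => u y - b y) ⟨z, Metric.mem_closedBall_self hρ.le⟩
    ((hu.continuousOn.mono hball).sub hbc.continuousOn)
  have hkey : 0 ≤ u w - b w := by
    by_contra! hneg
    have hwQ : Q w < ρ ^ 2 := (hbpos w).1 (by linarith [h0 w (hball hw)])
    have hwb : w ∈ Metric.ball z ρ := hin w hwQ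
    have hbε : b w < ε := by
      have h1 : Real.exp (-α * Q w) ≤ 1 := Real.exp_le_one_iff.2 (by nlinarith [hQ0 w])
      have h2 := Real.exp_pos (-α * ρ ^ 2)
      simp only [hb]
      nlinarith
    have hwr : r ^ 2 ≤ Q w := by
      by_contra! hlt
      have : dist w z < r := (dist_pi_lt_iff hr).2 fun i => by
        rw [Real.dist_eq]
        exact abs_lt_of_sq_lt_sq ((hcoord w i).trans_lt hlt) hr.le
      linarith [hru w this]
    have hloc : IsLocalMin (fun y => u y - b y) w :=
      hwmin.isLocalMin (Filter.mem_of_superset (Metric.isOpen_ball.mem_nhds hwb)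
        Metric.ball_subset_closedBall)
    have hupd : ∀ i s, Q (Function.update w i s) =
        (s - z i) ^ 2 + ∑ j ∈ Finset.univ.erase i, (w j - z j) ^ 2 := fun i s => by
      simp only [hQ]
      rw [← Finset.add_sum_erase _ _ (Finset.mem_univ i), Function.update_self]
      congr 1
      refine Finset.sum_congr rfl fun j hj => ?_
      rw [Function.update_of_ne (Finset.ne_of_mem_erase hj)]
    have hE : ∀ i t, HasDerivAt (fun s => ε * Real.exp (-α * Q (Function.update w i s)))
        (ε * (Real.exp (-α * Q (Function.update w i t)) * (-α * (2 * (t - z i))))) t :=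
      fun i t => by
        simp only [hupd]
        have := ((((hasDerivAt_id t).sub_const (z i)).pow 2).add_const
          (∑ j ∈ Finset.univ.erase i, (w j - z j) ^ 2)).const_mul (-α)
        refine (this.exp.const_mul ε).congr_deriv ?_
        simp
    have hle := sum_le_lap_of_isLocalMin_sub (huc w (hball hw)) hloc
      (b1 := fun i t => ε * Real.exp (-α * Q (Function.update w i t)) * (-α * (2 * (t - z i))))
      (b2 := fun i => ε * Real.exp (-α * Q w) * (4 * α ^ 2 * (w i - z i) ^ 2 - 2 * α))
      (fun i t => by
        have := (hE i t).sub_const (ε * Real.exp (-α * ρ ^ 2))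
        simp only [hb, mul_sub]
        exact this.congr_deriv (by ring))
      (fun i => by
        have h := (((hasDerivAt_id (w i)).sub_const (z i)).const_mul 2).const_mul (-α)
        refine ((hE i (w i)).mul h).congr_deriv ?_
        simp only [Function.update_eq_self, id]
        ring)
    rw [← Finset.mul_sum, Finset.sum_sub_distrib, ← Finset.mul_sum] at hle
    simp only [Finset.sum_const, Finset.card_univ, Fintype.card_fin, nsmul_eq_mul] at hle
    have hl := hlap w (hball hw) (by linarith)
    have hpos : 0 < 4 * α ^ 2 * Q w - N * (2 * α) := by
      have : 2 * α * r ^ 2 ≤ 2 * α * Q w := by gcongr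
      nlinarith
    have : 0 < ε * Real.exp (-α * Q w) * (4 * α ^ 2 * Q w - N * (2 * α)) := by positivity
    simp only [hQ] at this hle
    linarith
  have hxb : 0 < b x := (hbpos x).2 hx
  have := hwmin (Metric.ball_subset_closedBall (hin x hx))
  simp only [Set.mem_ofPred_eq] at this
  linarith

/-- Strong maximum principle: a nonnegative function on a connected open set that is superharmonic
where it is less than `μ` is positive as soon as it is positive somewhere. -/
lemma pos_of_lap_nonpos {N : ℕ} {u : (Fin N → ℝ) → ℝ} {Ω : Set (Fin N → ℝ)} (hΩ : IsOpen Ω)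
    (hconn : IsPreconnected Ω)
    (hu : ContDiffOn ℝ 2 u Ω) (h0 : ∀ x ∈ Ω, 0 ≤ u x) {μ : ℝ} (hμ : 0 < μ)
    (hlap : ∀ x ∈ Ω, u x < μ → lap u x ≤ 0) (hne : ∃ z ∈ Ω, 0 < u z) :
    ∀ x ∈ Ω, 0 < u x := by
  set U : Set (Fin N → ℝ) := Ω ∩ u ⁻¹' Set.Ioi 0 with hU
  have hUo : IsOpen U := hu.continuousOn.isOpen_inter_preimage hΩ isOpen_Ioi
  obtain ⟨z₀, hz₀, hz₀u⟩ := hne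
  suffices Ω ⊆ U from fun x hx => (this hx).2
  refine hconn.subset_of_closure_inter_subset hUo ⟨z₀, hz₀, hz₀, hz₀u⟩ ?_
  rintro x ⟨hxc, hxΩ⟩
  refine ⟨hxΩ, ?_⟩
  obtain ⟨δ, hδ, hδΩ⟩ := Metric.nhds_basis_closedBall.mem_iff.1 (hΩ.mem_nhds hxΩ)
  obtain ⟨z, hz, hxz⟩ := Metric.mem_closure_iff.1 hxc (δ / 2 / (N + 1)) (by positivity)
  have hle : δ / 2 / (N + 1) ≤ δ / 2 := div_le_self (by positivity) (by simp)
  refine pos_of_sum_sq_lt hΩ hu h0 hμ hlap (half_pos hδ) (fun y hy => hδΩ ?_) hz.2 ?_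
  · rw [Metric.mem_closedBall] at hy ⊢
    linarith [dist_triangle y z x, dist_comm x z]
  · have h1 : ∀ i, (x i - z i) ^ 2 ≤ (δ / 2 / (N + 1)) ^ 2 := fun i => by
      have := (dist_le_pi_dist x z i).trans hxz.le
      rw [Real.dist_eq] at this
      exact sq_le_sq' (abs_le.1 this).1 (abs_le.1 this).2
    calc ∑ i, (x i - z i) ^ 2 ≤ ∑ _i : Fin N, (δ / 2 / (N + 1)) ^ 2 :=
          Finset.sum_le_sum fun i _ => h1 i
      _ = N * (δ / 2 / (N + 1)) ^ 2 := by simp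
      _ < (δ / 2) ^ 2 := by
        rw [div_pow, ← mul_div_assoc, div_lt_iff₀ (by positivity), mul_comm]
        gcongr
        nlinarith [(Nat.cast_nonneg N : (0 : ℝ) ≤ N)]

/-- A positive function with `lap u ≤ -c u` wherever `u ≤ ε` is at least `ε` at the centre of every
cube of the domain whose principal Dirichlet eigenvalue `N a ^ 2` is less than `c`. -/
lemma le_of_lap_le_neg_mul {N : ℕ} {u : (Fin N → ℝ) → ℝ} {Ω : Set (Fin N → ℝ)} (hΩ : IsOpen Ω)
    (hu : ContDiffOn ℝ 2 u Ω) (hpos : ∀ x ∈ Ω, 0 < u x) {ε c a : ℝ} (hε : 0 < ε)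
    (hlap : ∀ x ∈ Ω, u x ≤ ε → lap u x ≤ -c * u x) (ha : 0 < a) (hac : N * a ^ 2 < c)
    {y : Fin N → ℝ} (hball : Metric.closedBall y (Real.pi / (2 * a)) ⊆ Ω) : ε ≤ u y := by
  by_contra! hlt
  set ρ : ℝ := Real.pi / (2 * a) with hρdef
  have hρ : 0 < ρ := by have := Real.pi_pos; positivity
  have haρ : a * ρ = Real.pi / 2 := by rw [hρdef]; field_simp
  have hyB : y ∈ Metric.closedBall y ρ := Metric.mem_closedBall_self hρ.le
  set φ : (Fin N → ℝ) → ℝ := fun x => ∏ i, Real.cos (a * (x i - y i)) with hφ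
  have hφc : Continuous φ := by fun_prop
  have hφy : φ y = 1 := by simp [hφ]
  have hcont : ContinuousOn u (Metric.closedBall y ρ) := hu.continuousOn.mono hball
  obtain ⟨v, hv, hvmin⟩ := (isCompact_closedBall y ρ).exists_isMinOn ⟨y, hyB⟩ hcont
  have hv0 : 0 < u v := hpos v (hball hv)
  have hvy : u v ≤ u y := hvmin hyB
  set δ : ℝ := u v / ε with hδ
  have hδ0 : 0 < δ := by positivity
  have hδ1 : δ ≤ 1 := by rw [hδ, div_le_one hε]; linarith
  have hK : IsCompact (Metric.closedBall y ρ ∩ φ ⁻¹' Set.Ici δ) :=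
    (isCompact_closedBall y ρ).inter_right (isClosed_Ici.preimage hφc)
  have hyK : y ∈ Metric.closedBall y ρ ∩ φ ⁻¹' Set.Ici δ := ⟨hyB, by simpa [hφy] using hδ1⟩
  obtain ⟨w, ⟨hwB, hwδ⟩, hwmin⟩ := hK.exists_isMinOn (f := fun x => u x / φ x) ⟨y, hyK⟩
    ((hcont.mono Set.inter_subset_left).div hφc.continuousOn
      fun x hx => (hδ0.trans_le hx.2).ne')
  have hφw : 0 < φ w := hδ0.trans_le hwδ
  set k : ℝ := u w / φ w with hk
  have huw : u w = k * φ w := by rw [hk]; field_simp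
  have hk0 : 0 < k := div_pos (hpos w (hball hwB)) hφw
  have hkε : k < ε := by
    have := hwmin hyK
    simp only [Set.mem_ofPred_eq, hφy, div_one] at this
    exact this.trans_lt hlt
  have htouch : ∀ x ∈ Metric.closedBall y ρ, k * φ x ≤ u x := fun x hx => by
    by_cases hxδ : δ ≤ φ x
    · have := hwmin (show x ∈ Metric.closedBall y ρ ∩ φ ⁻¹' Set.Ici δ from ⟨hx, hxδ⟩)
      exact (le_div_iff₀ (hδ0.trans_le hxδ)).1 this
    · have h1 : ε * δ = u v := by rw [hδ]; field_simp
      have h2 : u v ≤ u x := hvmin hx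
      push Not at hxδ
      nlinarith
  have hwb : w ∈ Metric.ball y ρ := by
    refine (dist_pi_lt_iff hρ).2 fun i => lt_of_le_of_ne ((dist_pi_le_iff hρ.le).1 hwB i) ?_
    intro heq
    rw [Real.dist_eq] at heq
    refine hφw.ne' (Finset.prod_eq_zero (Finset.mem_univ i) ?_)
    rw [← Real.cos_abs, abs_mul, abs_of_pos ha, heq, haρ, Real.cos_pi_div_two]
  have hloc : IsLocalMin (fun x => u x - k * φ x) w := by
    filter_upwards [Metric.isOpen_ball.mem_nhds hwb] with x hx
    have := htouch x (Metric.ball_subset_closedBall hx)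
    rw [huw]
    linarith
  have hupd : ∀ i s, φ (Function.update w i s) = Real.cos (a * (s - y i)) *
      ∏ j ∈ Finset.univ.erase i, Real.cos (a * (w j - y j)) := fun i s => by
    simp only [hφ]
    rw [← Finset.mul_prod_erase _ _ (Finset.mem_univ i), Function.update_self]
    congr 1
    refine Finset.prod_congr rfl fun j hj => ?_
    rw [Function.update_of_ne (Finset.ne_of_mem_erase hj)]
  have hlin : ∀ i t, HasDerivAt (fun s : ℝ => a * (s - y i)) a t := fun i t => by
    simpa using ((hasDerivAt_id t).sub_const (y i)).const_mul a
  have hle := sum_le_lap_of_isLocalMin_sub (hu.contDiffAt (hΩ.mem_nhds (hball hwB))) hloc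
    (b1 := fun i t => k * (-Real.sin (a * (t - y i)) * a *
      ∏ j ∈ Finset.univ.erase i, Real.cos (a * (w j - y j))))
    (b2 := fun _ => -a ^ 2 * (k * φ w))
    (fun i t => by
      simp only [hupd]
      exact ((hlin i t).cos.mul_const _).const_mul k)
    (fun i => by
      refine ((((hlin i (w i)).sin.neg.mul_const a).mul_const _).const_mul k).congr_deriv ?_
      have := hupd i (w i)
      rw [Function.update_eq_self] at this
      rw [this]
      ring)
  simp only [Finset.sum_const, Finset.card_univ, Fintype.card_fin, nsmul_eq_mul] at hle
  rw [← huw] at hle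
  have huwε : u w ≤ ε := by
    have : φ w ≤ 1 := by
      refine (le_abs_self _).trans ?_
      rw [hφ, Finset.abs_prod]
      exact Finset.prod_le_one (fun _ _ => abs_nonneg _) fun _ _ => Real.abs_cos_le_one _
    rw [huw]
    nlinarith
  have := hlap w (hball hwB) huwε
  nlinarith [hpos w (hball hwB)]

/-- Under (H1), `f` dominates a positive linear function near `0`. -/
lemma H1.exists_mul_le {f : ℝ → ℝ} {μ' μ : ℝ} (hf : H1 f μ' μ) :
    ∃ c > 0, ∃ ε > 0, ∀ s, 0 < s → s ≤ ε → c * s ≤ f s := by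
  obtain ⟨hlip, -, -, -, -, -, hzero⟩ := hf
  have hev : ∃ c > 0, ∀ᶠ s in nhdsWithin (0 : ℝ) (Set.Ioi 0), c * s ≤ f s := by
    rcases hzero with h0 | ⟨-, c, hc, h⟩
    · obtain ⟨L, hL⟩ := hlip 1
      have hc : ContinuousWithinAt f (Set.Icc 0 1) 0 := hL.continuousOn 0 (by simp)
      have h1 : ∀ᶠ s in nhdsWithin (0 : ℝ) (Set.Icc 0 1), f 0 / 2 < f s :=
        hc.eventually (lt_mem_nhds (half_lt_self h0))
      have h2 : Set.Ioc (0 : ℝ) 1 ∈ nhdsWithin (0 : ℝ) (Set.Ioi 0) := Ioc_mem_nhdsGT one_pos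
      have h3 : nhdsWithin (0 : ℝ) (Set.Ioi 0) ≤ nhdsWithin (0 : ℝ) (Set.Icc 0 1) :=
        nhdsWithin_le_of_mem (Filter.mem_of_superset h2 Set.Ioc_subset_Icc_self)
      refine ⟨f 0 / 2, half_pos h0, ?_⟩
      filter_upwards [h3 h1, h2] with s hs hs'
      have hs1 : f 0 / 2 < f s := hs
      nlinarith [hs'.1, hs'.2]
    · refine ⟨c, hc, ?_⟩
      filter_upwards [h, self_mem_nhdsWithin] with s hs hs'
      exact (le_div_iff₀ hs').1 hs
  obtain ⟨c, hc, h⟩ := hev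
  obtain ⟨ε, hε, hsub⟩ := mem_nhdsGT_iff_exists_Ioc_subset.1 h
  exact ⟨c, hc, ε, hε, fun s h1 h2 => hsub ⟨h1, h2⟩⟩

/-- Step 1 of the proof of Theorem 1.1: under (H1), any nontrivial bounded nonnegative
solution of the quarter-space problem is bounded from below by some `ε > 0` on
`[R,+∞) × ℝ^{N-2} × [R,+∞)` for some `R > 0`. -/
theorem stmt_13
    (f : ℝ → ℝ) (μ' μ : ℝ) (hf : H1 f μ' μ)
    {N : ℕ} (hN : 2 ≤ N) (i0 iN : Fin N) (hi0 : (i0 : ℕ) = 0) (hiN : (iN : ℕ) = N - 1)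
    (u u₀ : (Fin N → ℝ) → ℝ)
    (hu_smooth : ContDiffOn ℝ 2 u {x : Fin N → ℝ | 0 < x i0 ∧ 0 < x iN})
    (hu_cont : ContinuousOn u
      ({x : Fin N → ℝ | 0 ≤ x i0 ∧ 0 ≤ x iN} \ {x : Fin N → ℝ | x i0 = 0 ∧ x iN = 0}))
    (hu_nonneg : ∀ x : Fin N → ℝ, 0 ≤ x i0 → 0 ≤ x iN → ¬(x i0 = 0 ∧ x iN = 0) → 0 ≤ u x)
    (hu_bdd : ∃ C, ∀ x : Fin N → ℝ, 0 ≤ x i0 → 0 ≤ x iN → ¬(x i0 = 0 ∧ x iN = 0) → u x ≤ C)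
    (hu_pde : ∀ x : Fin N → ℝ, 0 < x i0 → 0 < x iN → lap u x + f (u x) = 0)
    (hu_bot : ∀ x : Fin N → ℝ, 0 < x i0 → x iN = 0 → u x = 0)
    (hu_init : ∀ x : Fin N → ℝ, x i0 = 0 → 0 < x iN → u x = u₀ x)
    (hu₀_cont : ContinuousOn u₀ {x : Fin N → ℝ | x i0 = 0 ∧ 0 < x iN})
    (hu₀_bdd : ∃ C, ∀ x : Fin N → ℝ, x i0 = 0 → 0 < x iN → u₀ x ≤ C)
    (hu₀_nonneg : ∀ x : Fin N → ℝ, x i0 = 0 → 0 < x iN → 0 ≤ u₀ x)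
    (hu₀_ne : ∃ x : Fin N → ℝ, x i0 = 0 ∧ 0 < x iN ∧ u₀ x ≠ 0) :
    ∃ ε : ℝ, 0 < ε ∧ ∃ R : ℝ, 0 < R ∧
      ∀ x : Fin N → ℝ, R ≤ x i0 → R ≤ x iN → ε ≤ u x := by
  set Ω : Set (Fin N → ℝ) := {x | 0 < x i0 ∧ 0 < x iN} with hΩdef
  have hΩ : IsOpen Ω :=
    (isOpen_lt continuous_const (continuous_apply i0)).inter
      (isOpen_lt continuous_const (continuous_apply iN))
  have hconn : IsPreconnected Ω :=
    ((convex_halfSpace_gt (LinearMap.proj (R := ℝ) (φ := fun _ : Fin N => ℝ) i0).isLinear 0).inter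
      (convex_halfSpace_gt (LinearMap.proj (R := ℝ) (φ := fun _ : Fin N => ℝ) iN).isLinear
        0)).isPreconnected
  have hnn : ∀ x ∈ Ω, 0 ≤ u x := fun x hx =>
    hu_nonneg x hx.1.le hx.2.le fun h => hx.1.ne' h.1
  have hf' := hf
  obtain ⟨-, hμ', hμμ, hfpos, -, -, hf0⟩ := hf'
  have hf0 : 0 ≤ f 0 := hf0.elim le_of_lt fun h => h.1.ge
  have hlap : ∀ x ∈ Ω, u x < μ → lap u x ≤ 0 := fun x hx hxμ => by
    have h1 := hu_pde x hx.1 hx.2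
    have h2 : 0 ≤ f (u x) := by
      rcases (hnn x hx).eq_or_lt with h | h
      · rwa [← h]
      · exact (hfpos _ h hxμ).le
    linarith
  have hpos : ∀ x ∈ Ω, 0 < u x := by
    refine pos_of_lap_nonpos hΩ hconn hu_smooth hnn (hμ'.trans hμμ) hlap ?_
    obtain ⟨z, hz0, hzN, hz⟩ := hu₀_ne
    have hne : iN ≠ i0 := fun h => by rw [h] at hzN; exact hzN.ne' hz0
    have huz : 0 < u z := by
      rw [hu_init z hz0 hzN]
      exact lt_of_le_of_ne (hu₀_nonneg z hz0 hzN) hz.symm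
    have hcw := hu_cont z ⟨⟨hz0.ge, hzN.le⟩, fun h => hzN.ne' h.2⟩
    have ht : Tendsto (fun t : ℝ => Function.update z i0 t) (nhdsWithin 0 (Set.Ioi 0))
        (nhdsWithin z ({x : Fin N → ℝ | 0 ≤ x i0 ∧ 0 ≤ x iN} \
          {x : Fin N → ℝ | x i0 = 0 ∧ x iN = 0})) := by
      refine tendsto_nhdsWithin_iff.2 ⟨?_, ?_⟩
      · have hc : Continuous fun t : ℝ => Function.update z i0 t :=
          continuous_const.update i0 continuous_id
        have := hc.tendsto 0
        rw [← hz0, Function.update_eq_self, hz0] at this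
        exact this.mono_left nhdsWithin_le_nhds
      · filter_upwards [self_mem_nhdsWithin] with t ht
        have ht : 0 < t := ht
        simp [Function.update_of_ne hne, ht.le, hzN.le, ht.ne']
    obtain ⟨t, hut, ht0⟩ := ((ht.eventually (hcw.eventually (lt_mem_nhds huz))).and
      self_mem_nhdsWithin).exists
    refine ⟨Function.update z i0 t, ⟨?_, ?_⟩, hut⟩
    · rw [Function.update_self]
      exact ht0
    · rwa [Function.update_of_ne hne]
  obtain ⟨c, hc, ε, hε, hfc⟩ := hf.exists_mul_le
  obtain ⟨a, ha, hac⟩ : ∃ a > 0, (N : ℝ) * a ^ 2 < c := by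
    have hlim : Tendsto (fun a : ℝ => (N : ℝ) * a ^ 2) (nhdsWithin 0 (Set.Ioi 0)) (nhds 0) := by
      have : Continuous fun a : ℝ => (N : ℝ) * a ^ 2 := by fun_prop
      simpa using (this.tendsto 0).mono_left nhdsWithin_le_nhds
    obtain ⟨a, h1, h2⟩ := ((hlim.eventually (gt_mem_nhds hc)).and self_mem_nhdsWithin).exists
    exact ⟨a, h2, h1⟩
  have hρ : 0 < Real.pi / (2 * a) := by have := Real.pi_pos; positivity
  refine ⟨ε, hε, Real.pi / (2 * a) + 1, by positivity, fun y hy0 hyN => ?_⟩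
  refine le_of_lap_le_neg_mul hΩ hu_smooth hpos hε (fun x hx hxε => ?_) ha hac fun x hx => ?_
  · have := hfc (u x) (hpos x hx) hxε
    linarith [hu_pde x hx.1 hx.2]
  · have h := (dist_pi_le_iff hρ.le).1 hx
    have h0 := (abs_le.1 (h i0)).1
    have hN := (abs_le.1 (h iN)).1
    exact ⟨by linarith, by linarith⟩
end
end

section
/- Let f : [0,+∞) → ℝ be locally Lipschitz-continuous with f(0) ≥ 0, and let V ∈ C²([0,+∞)) be a bounded nonnegative solution of V''(ξ) + f(V(ξ)) = 0 for all ξ ≥ 0 with V(0) = 0. Then V is nondecreasing on [0,+∞); moreover, either V ≡ 0 on [0,+∞), or V'(ξ) > 0 for all ξ ≥ 0. -/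
open Set Filter

noncomputable section

/-- Two solutions of `u'' + f(u) = 0` on `[0, T]` with values in a set `[0, b]` on which `f` is
Lipschitz, and with the same Cauchy data at `0`, coincide together with their derivatives. -/
lemma eqOn_of_secondOrder_autonomous {f : ℝ → ℝ} {b T : ℝ} {L : NNReal}
    (hf : LipschitzOnWith L f (Icc 0 b)) {u u' w w' : ℝ → ℝ}
    (hu : ∀ t ∈ Icc 0 T, HasDerivWithinAt u (u' t) (Icc 0 T) t)
    (hu' : ∀ t ∈ Icc 0 T, HasDerivWithinAt u' (-(f (u t))) (Icc 0 T) t)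
    (hub : ∀ t ∈ Icc 0 T, u t ∈ Icc 0 b)
    (hw : ∀ t ∈ Icc 0 T, HasDerivWithinAt w (w' t) (Icc 0 T) t)
    (hw' : ∀ t ∈ Icc 0 T, HasDerivWithinAt w' (-(f (w t))) (Icc 0 T) t)
    (hwb : ∀ t ∈ Icc 0 T, w t ∈ Icc 0 b)
    (h0 : u 0 = w 0) (h0' : u' 0 = w' 0) :
    EqOn (fun t => (u t, u' t)) (fun t => (w t, w' t)) (Icc 0 T) := by
  have hlip : LipschitzOnWith (max 1 L) (fun p : ℝ × ℝ => (p.2, -(f p.1)))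
      (Icc 0 b ×ˢ univ) := by
    refine (LipschitzWith.prod_snd.lipschitzOnWith).prodMk ?_
    have h := hf.neg.comp ((LipschitzWith.prod_fst (α := ℝ) (β := ℝ)).lipschitzOnWith
      (s := Icc 0 b ×ˢ univ)) (fun p hp => hp.1)
    rwa [mul_one] at h
  have hmem : ∀ t ∈ Ico 0 T, Icc 0 T ∈ nhdsWithin t (Ici t) := fun t ht =>
    mem_of_superset (Icc_mem_nhdsGE ht.2) (Icc_subset_Icc_left ht.1)
  refine ODE_solution_unique_of_mem_Icc_right (v := fun _ p => (p.2, -(f p.1)))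
    (s := fun _ => Icc 0 b ×ˢ univ) (K := max 1 L) (fun _ _ => hlip)
    (fun t ht => ((hu t ht).prodMk (hu' t ht)).continuousWithinAt)
    (fun t ht => ?_) (fun t ht => ⟨hub t (Ico_subset_Icc_self ht), mem_univ _⟩)
    (fun t ht => ((hw t ht).prodMk (hw' t ht)).continuousWithinAt)
    (fun t ht => ?_) (fun t ht => ⟨hwb t (Ico_subset_Icc_self ht), mem_univ _⟩)
    (Prod.ext h0 h0')
  · have ht' := Ico_subset_Icc_self ht
    exact ((hu t ht').prodMk (hu' t ht')).mono_of_mem_nhdsWithin (hmem t ht)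
  · have ht' := Ico_subset_Icc_self ht
    exact ((hw t ht').prodMk (hw' t ht')).mono_of_mem_nhdsWithin (hmem t ht)

/-- A function vanishing at `0` with negative right derivative there is negative just to the
right of `0`. -/
lemma exists_forall_Ioo_neg_of_hasDerivWithinAt_neg {g : ℝ → ℝ} {d : ℝ}
    (hg : HasDerivWithinAt g d (Ici 0) 0) (hg0 : g 0 = 0) (hd : d < 0) :
    ∃ δ > 0, ∀ t ∈ Ioo 0 δ, g t < 0 := by
  have h := (hasDerivWithinAt_iff_tendsto_slope' self_notMem_Ioi).1 hg.Ioi_of_Ici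
  obtain ⟨δ, hδ, hsub⟩ := mem_nhdsGT_iff_exists_Ioo_subset.1 (h.eventually (gt_mem_nhds hd))
  refine ⟨δ, hδ, fun t ht => ?_⟩
  have hs : slope g 0 t < 0 := hsub ht
  rw [slope_def_field, hg0, sub_zero, sub_zero] at hs
  by_contra! hcon
  exact absurd (div_nonneg hcon ht.1.le) hs.not_ge

/-- For `f` locally Lipschitz on `[0,∞)` with `f(0) ≥ 0`, every bounded nonnegative `C²`
solution of `V'' + f(V) = 0` on `[0,∞)` with `V(0) = 0` is nondecreasing, and either
`V ≡ 0` or `V' > 0` everywhere on `[0,∞)`. -/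
theorem stmt_14
    (f : ℝ → ℝ) (hf_lip : LocLipOn f) (hf0 : 0 ≤ f 0)
    (V V' : ℝ → ℝ)
    (hV : ∀ ξ ∈ Set.Ici (0:ℝ), HasDerivWithinAt V (V' ξ) (Set.Ici 0) ξ)
    (hV' : ∀ ξ ∈ Set.Ici (0:ℝ), HasDerivWithinAt V' (-(f (V ξ))) (Set.Ici 0) ξ)
    (hV0 : V 0 = 0)
    (hVnonneg : ∀ ξ, 0 ≤ ξ → 0 ≤ V ξ)
    (hVbdd : ∃ C, ∀ ξ, 0 ≤ ξ → V ξ ≤ C) :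
    (∀ ξ₁ ξ₂ : ℝ, 0 ≤ ξ₁ → ξ₁ ≤ ξ₂ → V ξ₁ ≤ V ξ₂) ∧
    ((∀ ξ, 0 ≤ ξ → V ξ = 0) ∨ (∀ ξ, 0 ≤ ξ → 0 < V' ξ)) := by
  obtain ⟨C, hC⟩ := hVbdd
  obtain ⟨L, hL⟩ := hf_lip C
  have hVmem : ∀ ξ, 0 ≤ ξ → V ξ ∈ Icc 0 C := fun ξ h => ⟨hVnonneg ξ h, hC ξ h⟩
  have hVat : ∀ ξ, 0 < ξ → HasDerivAt V (V' ξ) ξ := fun ξ h =>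
    (hV ξ h.le).hasDerivAt (Ici_mem_nhds h)
  have hVcont : ContinuousOn V (Ici 0) := fun ξ h => (hV ξ h).continuousWithinAt
  have hVcont' : ContinuousOn V' (Ici 0) := fun ξ h => (hV' ξ h).continuousWithinAt
  have hderiv0 : 0 ≤ V' 0 := by
    by_contra! hneg
    obtain ⟨δ, hδ, h⟩ :=
      exists_forall_Ioo_neg_of_hasDerivWithinAt_neg (hV 0 self_mem_Ici) hV0 hneg
    exact absurd (hVnonneg (δ / 2) (by positivity))
      (h (δ / 2) ⟨by positivity, by linarith⟩).not_ge
  rcases hderiv0.eq_or_lt' with hz | hpos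
  · have hf00 : f 0 = 0 := by
      refine le_antisymm ?_ hf0
      by_contra! hfpos
      obtain ⟨δ, hδ, h⟩ := exists_forall_Ioo_neg_of_hasDerivWithinAt_neg
        (hV' 0 self_mem_Ici) hz (by rw [hV0]; linarith)
      have hδ2 : 0 < δ / 2 := by positivity
      obtain ⟨c, hc, hceq⟩ := exists_hasDerivAt_eq_slope V V' hδ2
        (hVcont.mono Icc_subset_Ici_self) (fun x hx => hVat x hx.1)
      have hcneg := h c ⟨hc.1, by linarith [hc.2]⟩
      rw [hceq, hV0, sub_zero, sub_zero] at hcneg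
      exact absurd (div_nonneg (hVnonneg _ hδ2.le) hδ2.le) hcneg.not_ge
    have hzero : ∀ ξ, 0 ≤ ξ → V ξ = 0 := fun ξ hξ => by
      have h := eqOn_of_secondOrder_autonomous (T := ξ) (w := fun _ => 0) (w' := fun _ => 0) hL
        (fun t ht => (hV t ht.1).mono Icc_subset_Ici_self)
        (fun t ht => (hV' t ht.1).mono Icc_subset_Ici_self)
        (fun t ht => hVmem t ht.1)
        (fun t _ => hasDerivWithinAt_const ..)
        (fun t _ => by simpa [hf00] using hasDerivWithinAt_const t (Icc 0 ξ) (0 : ℝ))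
        (fun t _ => ⟨le_rfl, hV0 ▸ hC 0 le_rfl⟩) hV0 hz (right_mem_Icc.2 hξ)
      exact congrArg Prod.fst h
    exact ⟨fun a b ha hab => by rw [hzero a ha, hzero b (ha.trans hab)], Or.inl hzero⟩
  · have hne : ∀ ξ, 0 ≤ ξ → V' ξ ≠ 0 := fun ξ hξ hzero => by
      rcases hξ.eq_or_lt' with rfl | hξpos
      · exact hpos.ne' hzero
      have hr : ∀ t ∈ Icc 0 ξ, HasDerivWithinAt (fun t => ξ + t) 1 (Icc 0 ξ) t := fun t _ =>
        ((hasDerivAt_id t).const_add ξ).hasDerivWithinAt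
      have hl : ∀ t ∈ Icc 0 ξ, HasDerivWithinAt (fun t => ξ - t) (-1) (Icc 0 ξ) t := fun t _ =>
        ((hasDerivAt_id t).const_sub ξ).hasDerivWithinAt
      have hrm : MapsTo (fun t => ξ + t) (Icc 0 ξ) (Ici 0) := fun t ht => add_nonneg hξ ht.1
      have hlm : MapsTo (fun t => ξ - t) (Icc 0 ξ) (Ici 0) := fun t ht => sub_nonneg.2 ht.2
      -- by uniqueness, `V` is symmetric with respect to its critical point `ξ`
      have h := eqOn_of_secondOrder_autonomous (T := ξ)
        (u := fun t => V (ξ + t)) (u' := fun t => V' (ξ + t))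
        (w := fun t => V (ξ - t)) (w' := fun t => -V' (ξ - t)) hL
        (fun t ht => ((hV _ (hrm ht)).comp t (hr t ht) hrm).congr_deriv (by simp))
        (fun t ht => ((hV' _ (hrm ht)).comp t (hr t ht) hrm).congr_deriv (by simp))
        (fun t ht => hVmem _ (hrm ht))
        (fun t ht => ((hV _ (hlm ht)).comp t (hl t ht) hlm).congr_deriv (by simp))
        (fun t ht => ((hV' _ (hlm ht)).comp t (hl t ht) hlm).neg.congr_deriv (by simp))
        (fun t ht => hVmem _ (hlm ht)) (by simp) (by simp [hzero]) (right_mem_Icc.2 hξ)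
      have h1 : V (ξ + ξ) = 0 := by simpa [hV0] using congrArg Prod.fst h
      have h2 : V' (ξ + ξ) = -V' 0 := by simpa using congrArg Prod.snd h
      have hpos2 : 0 < ξ + ξ := by positivity
      have hmin : IsLocalMin V (ξ + ξ) := by
        filter_upwards [Ici_mem_nhds hpos2] with x hx
        rw [h1]
        exact hVnonneg x hx
      have := hmin.hasDerivAt_eq_zero (hVat _ hpos2)
      linarith
    have hVpos : ∀ ξ, 0 ≤ ξ → 0 < V' ξ := fun ξ hξ => by
      by_contra! hle
      obtain ⟨c, hc, hc0⟩ := intermediate_value_Icc' hξ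
        (hVcont'.mono Icc_subset_Ici_self) ⟨hle, hpos.le⟩
      exact hne c hc.1 hc0
    have hmono : MonotoneOn V (Ici 0) :=
      monotoneOn_of_hasDerivWithinAt_nonneg (convex_Ici 0) hVcont
        (fun x hx => (hV x (interior_subset hx)).mono interior_subset)
        (fun x hx => (hVpos x (interior_subset hx)).le)
    exact ⟨fun a b ha hab => hmono ha (mem_Ici.2 (ha.trans hab)) hab, Or.inr hVpos⟩
end
end

section
/- Let f : [0,+∞) → ℝ be locally Lipschitz-continuous with f(0) ≥ 0, let V ∈ C²([0,+∞)) be a bounded nonnegative solution of V''(ξ) + f(V(ξ)) = 0 for all ξ ≥ 0 with V(0) = 0, and let z₀ = lim_{ξ→+∞} V(ξ) (which exists since V is nondecreasing and bounded). Then f(z₀) = 0, V'(0)² = 2F(z₀), and V'(ξ)² = 2(F(z₀) − F(V(ξ))) for all ξ ≥ 0, where F(z) = ∫₀^z f(σ) dσ. -/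
open Set Filter

noncomputable section

/-- If a function converges at `+∞`, its derivative tends to zero along some sequence
going to `+∞`. -/
theorem exists_seq_tendsto_deriv_zero {g g' : ℝ → ℝ} {a : ℝ}
    (hg : ∀ ξ ∈ Set.Ici (0:ℝ), HasDerivWithinAt g (g' ξ) (Set.Ici 0) ξ)
    (ha : Tendsto g atTop (nhds a)) :
    ∃ s : ℕ → ℝ, Tendsto s atTop atTop ∧ Tendsto (fun n => g' (s n)) atTop (nhds 0) := by
  have key : ∀ n : ℕ, ∃ c ∈ Set.Ioo (n:ℝ) (n + 1), g' c = g (n + 1) - g n := by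
    intro n
    have hn : (0:ℝ) ≤ n := n.cast_nonneg
    obtain ⟨c, hc, h⟩ := exists_hasDerivAt_eq_slope g g' (lt_add_one (n:ℝ))
      (fun x hx => ((hg x (hn.trans hx.1)).continuousWithinAt).mono
        (fun y hy => hn.trans hy.1))
      (fun x hx => (hg x (hn.trans hx.1.le)).hasDerivAt (Ici_mem_nhds (hn.trans_lt hx.1)))
    exact ⟨c, hc, by rw [h]; simp⟩
  choose s hs h using key
  refine ⟨s, tendsto_atTop_mono (fun n => (hs n).1.le) tendsto_natCast_atTop_atTop, ?_⟩
  simp only [h]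
  have h1 : Tendsto (fun n : ℕ => g n) atTop (nhds a) := ha.comp tendsto_natCast_atTop_atTop
  have h2 : Tendsto (fun n : ℕ => g ((n:ℝ) + 1)) atTop (nhds a) :=
    ha.comp (tendsto_atTop_add_const_right _ _ tendsto_natCast_atTop_atTop)
  simpa using h2.sub h1

theorem LocLipOn.continuous_comp_max {f : ℝ → ℝ} (hf : LocLipOn f) :
    Continuous fun x => f (max x 0) := by
  rw [continuous_iff_continuousAt]
  intro x
  obtain ⟨L, hL⟩ := hf (|x| + 1)
  have hc : ContinuousOn (fun y => f (max y 0)) (Set.Iic (|x| + 1)) :=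
    hL.continuousOn.comp (by fun_prop)
      fun y hy => ⟨le_max_right _ _, max_le hy (by positivity)⟩
  exact hc.continuousAt (Iic_mem_nhds (by linarith [le_abs_self x]))

theorem Ff_comp_max_of_nonneg (f : ℝ → ℝ) {z : ℝ} (hz : 0 ≤ z) :
    Ff (fun x => f (max x 0)) z = Ff f z := by
  refine intervalIntegral.integral_congr fun x hx => ?_
  rw [Set.uIcc_of_le hz] at hx
  simp [max_eq_left hx.1]

theorem hasDerivAt_Ff {f : ℝ → ℝ} (hf : Continuous f) (z : ℝ) :
    HasDerivAt (Ff f) (f z) z :=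
  (hf.integral_hasStrictDerivAt 0 z).hasDerivAt

/-- First-integral identities: for a bounded nonnegative `C²` solution of `V'' + f(V) = 0` on
`[0,∞)` with `V(0) = 0` and limit `z₀` at `+∞`, one has `f(z₀) = 0`, `V'(0)² = 2F(z₀)` and
`V'(ξ)² = 2(F(z₀) - F(V(ξ)))` for all `ξ ≥ 0`. -/
theorem stmt_15
    (f : ℝ → ℝ) (hf_lip : LocLipOn f) (hf0 : 0 ≤ f 0)
    (V V' : ℝ → ℝ)
    (hV : ∀ ξ ∈ Set.Ici (0:ℝ), HasDerivWithinAt V (V' ξ) (Set.Ici 0) ξ)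
    (hV' : ∀ ξ ∈ Set.Ici (0:ℝ), HasDerivWithinAt V' (-(f (V ξ))) (Set.Ici 0) ξ)
    (hV0 : V 0 = 0)
    (hVnonneg : ∀ ξ, 0 ≤ ξ → 0 ≤ V ξ)
    (hVbdd : ∃ C, ∀ ξ, 0 ≤ ξ → V ξ ≤ C)
    (z₀ : ℝ) (hz₀ : Filter.Tendsto V Filter.atTop (nhds z₀)) :
    f z₀ = 0 ∧ V' 0 ^ 2 = 2 * Ff f z₀ ∧
    ∀ ξ, 0 ≤ ξ → V' ξ ^ 2 = 2 * (Ff f z₀ - Ff f (V ξ)) := by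
  obtain ⟨h, hfh⟩ : ∃ h : ℝ → ℝ, h = fun x => f (max x 0) := ⟨_, rfl⟩
  have hh : Continuous h := hfh ▸ hf_lip.continuous_comp_max
  have hf_eq : ∀ z, 0 ≤ z → f z = h z := fun z hz => by simp [hfh, max_eq_left hz]
  have hF_eq : ∀ z, 0 ≤ z → Ff f z = Ff h z := fun z hz =>
    hfh ▸ (Ff_comp_max_of_nonneg f hz).symm
  have hz₀_nonneg : 0 ≤ z₀ :=
    ge_of_tendsto hz₀ ((eventually_ge_atTop 0).mono fun ξ hξ => hVnonneg ξ hξ)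
  have hE : ∀ ξ ∈ Set.Ici (0:ℝ),
      HasDerivWithinAt (fun ξ => V' ξ ^ 2 + 2 * Ff h (V ξ)) 0 (Set.Ici 0) ξ := by
    intro ξ hξ
    have := ((hV' ξ hξ).pow 2).add
      (((hasDerivAt_Ff hh (V ξ)).comp_hasDerivWithinAt ξ (hV ξ hξ)).const_mul 2)
    refine this.congr_deriv ?_
    rw [hf_eq _ (hVnonneg ξ hξ)]
    push_cast
    ring
  have hconst : ∀ ξ, 0 ≤ ξ → V' ξ ^ 2 + 2 * Ff h (V ξ) = V' 0 ^ 2 := by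
    intro ξ hξ
    have := constant_of_has_deriv_right_zero
      (fun x hx => (hE x hx.1).continuousWithinAt.mono fun y hy => hy.1)
      (fun x hx => (hE x hx.1).mono (Set.Ici_subset_Ici.2 hx.1)) ξ ⟨hξ, le_rfl⟩
    simpa [hV0, Ff] using this
  have hFlim : Tendsto (fun ξ => Ff h (V ξ)) atTop (nhds (Ff h z₀)) :=
    (hasDerivAt_Ff hh z₀).continuousAt.tendsto.comp hz₀
  have hsq : Tendsto (fun ξ => V' ξ ^ 2) atTop (nhds (V' 0 ^ 2 - 2 * Ff h z₀)) := by
    refine ((hFlim.const_mul 2).const_sub (V' 0 ^ 2)).congr' ?_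
    filter_upwards [eventually_ge_atTop 0] with ξ hξ
    linarith [hconst ξ hξ]
  obtain ⟨s, hs, hs0⟩ := exists_seq_tendsto_deriv_zero hV hz₀
  have hE0 : V' 0 ^ 2 - 2 * Ff h z₀ = 0 :=
    tendsto_nhds_unique (hsq.comp hs) (by simpa [Function.comp_def] using hs0.pow 2)
  have hV'lim : Tendsto V' atTop (nhds 0) := by
    rw [hE0] at hsq
    refine (tendsto_zero_iff_abs_tendsto_zero _).2 ?_
    simpa [Real.sqrt_sq_eq_abs, Function.comp_def] using hsq.sqrt
  obtain ⟨t, ht, ht0⟩ := exists_seq_tendsto_deriv_zero hV' hV'lim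
  have hfz : h z₀ = 0 := by
    have h1 : Tendsto (fun ξ => -f (V ξ)) atTop (nhds (-h z₀)) := by
      refine ((hh.tendsto z₀).comp hz₀).neg.congr' ?_
      filter_upwards [eventually_ge_atTop 0] with ξ hξ
      simp [hf_eq _ (hVnonneg ξ hξ)]
    simpa using tendsto_nhds_unique (h1.comp ht) ht0
  refine ⟨by rw [hf_eq _ hz₀_nonneg, hfz], by rw [hF_eq _ hz₀_nonneg]; linarith, fun ξ hξ => ?_⟩
  rw [hF_eq _ hz₀_nonneg, hF_eq _ (hVnonneg ξ hξ)]
  linarith [hconst ξ hξ]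
end
end

section
/- Let C ⊂ [0,1] be the standard Cantor ternary set and define f : [0,+∞) → ℝ by f(z) = dist(z, C), the distance from z to C. Then Z_f = C; in particular, Z_f is uncountable. -/
open Set Filter

noncomputable section

/-- A closed interval contained in the Cantor set has length at most `3⁻ⁿ` for every `n`. -/
theorem sub_le_pow_of_Icc_subset_cantorSet (n : ℕ) :
    ∀ a b : ℝ, a < b → Icc a b ⊆ cantorSet → b - a ≤ (1 / 3 : ℝ) ^ n := by
  induction n with
  | zero =>
    intro a b hab h
    have ha := cantorSet_subset_unitInterval (h (left_mem_Icc.2 hab.le))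
    have hb := cantorSet_subset_unitInterval (h (right_mem_Icc.2 hab.le))
    have := ha.1
    have := hb.2
    simp only [pow_zero]
    linarith
  | succ n ih =>
    intro a b hab h
    have halves : ∀ x ∈ cantorSet, ∃ y ∈ cantorSet, y / 3 = x ∨ (2 + y) / 3 = x := by
      intro x hx
      rw [cantorSet_eq_union_halves] at hx
      rcases hx with ⟨y, hy, rfl⟩ | ⟨y, hy, rfl⟩
      · exact ⟨y, hy, Or.inl rfl⟩
      · exact ⟨y, hy, Or.inr rfl⟩
    have side : ∀ x ∈ cantorSet, x ≤ 1 / 3 ∨ 2 / 3 ≤ x := by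
      intro x hx
      obtain ⟨y, hy, hyx⟩ := halves x hx
      obtain ⟨h0, h1⟩ := cantorSet_subset_unitInterval hy
      rcases hyx with rfl | rfl
      · left; linarith
      · right; linarith
    have hb1 := (cantorSet_subset_unitInterval (h (right_mem_Icc.2 hab.le))).2
    have ha0 := (cantorSet_subset_unitInterval (h (left_mem_Icc.2 hab.le))).1
    have gap : b ≤ 1 / 3 ∨ 2 / 3 ≤ a := by
      by_contra! hc
      obtain ⟨x, hx1, hx2⟩ := exists_between
        (show max a (1 / 3) < min b (2 / 3) by
          simp only [lt_min_iff, max_lt_iff]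
          exact ⟨⟨hab, hc.1⟩, hc.2, by norm_num⟩)
      obtain ⟨hxa, hx3⟩ := max_lt_iff.1 hx1
      obtain ⟨hxb, hx4⟩ := lt_min_iff.1 hx2
      rcases side x (h ⟨hxa.le, hxb.le⟩) with h' | h' <;> linarith
    rw [pow_succ]
    rcases gap with hb | ha
    · have := ih (3 * a) (3 * b) (by linarith) (by
        rintro x ⟨hx1, hx2⟩
        obtain ⟨y, hy, hyx⟩ := halves (x / 3) (h ⟨by linarith, by linarith⟩)
        have hy0 := (cantorSet_subset_unitInterval hy).1
        rcases hyx with e | e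
        · rwa [show x = y by linarith]
        · linarith)
      linarith
    · have := ih (3 * a - 2) (3 * b - 2) (by linarith) (by
        rintro x ⟨hx1, hx2⟩
        obtain ⟨y, hy, hyx⟩ := halves ((2 + x) / 3) (h ⟨by linarith, by linarith⟩)
        have hy1 := (cantorSet_subset_unitInterval hy).2
        rcases hyx with e | e
        · linarith
        · rwa [show x = y by linarith])
      linarith

theorem not_Icc_subset_cantorSet {a b : ℝ} (hab : a < b) : ¬ Icc a b ⊆ cantorSet := by
  intro h
  obtain ⟨n, hn⟩ := exists_pow_lt_of_lt_one (sub_pos.2 hab) (by norm_num : (1 / 3 : ℝ) < 1)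
  exact absurd (sub_le_pow_of_Icc_subset_cantorSet n a b hab h) (not_le.2 hn)

theorem not_countable_cantorSet : ¬ cantorSet.Countable := by
  intro h
  have : Countable cantorSet := h.to_subtype
  have : Countable (ℕ → Bool) := cantorSetEquivNatToBool.symm.injective.countable
  have hle : Cardinal.mk (ℕ → Bool) ≤ Cardinal.aleph0 := Cardinal.mk_le_aleph0
  simp only [Cardinal.mk_pi, Cardinal.mk_bool, Cardinal.prod_const, Cardinal.mk_nat,
    Cardinal.lift_id] at hle
  exact absurd hle (not_le.2 (Cardinal.cantor _))

theorem strictMono_Ff_infDist_cantorSet :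
    StrictMono (Ff fun z => Metric.infDist z cantorSet) := by
  intro w z hwz
  have hcont : Continuous fun z : ℝ => Metric.infDist z cantorSet :=
    Metric.continuous_infDist_pt _
  obtain ⟨c, hc, hcC⟩ := not_subset.1 (not_Icc_subset_cantorSet hwz)
  have hpos : 0 < ∫ x in w..z, Metric.infDist x cantorSet :=
    intervalIntegral.integral_pos hwz hcont.continuousOn (fun _ _ => Metric.infDist_nonneg)
      ⟨c, hc, (isClosed_cantorSet.notMem_iff_infDist_pos ⟨0, zero_mem_cantorSet⟩).1 hcC⟩
  rw [← intervalIntegral.integral_interval_sub_left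
    (hcont.intervalIntegrable 0 z) (hcont.intervalIntegrable 0 w)] at hpos
  exact sub_pos.1 hpos

theorem Zf_infDist_cantorSet : Zf (fun z => Metric.infDist z cantorSet) = cantorSet := by
  ext z
  have hmem := isClosed_cantorSet.mem_iff_infDist_zero ⟨0, zero_mem_cantorSet⟩ (x := z)
  exact ⟨fun h => hmem.2 h.2.1, fun h => ⟨(cantorSet_subset_unitInterval h).1, hmem.1 h,
    fun _ _ hwz => strictMono_Ff_infDist_cantorSet hwz⟩⟩

/-- Remark 4.1: for `f(z) = dist(z, 𝒞)` with `𝒞 = cantorSet` the standard Cantor ternary set,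
one has `Z_f = 𝒞`; in particular `Z_f` is uncountable. -/
theorem stmt_17 :
    Zf (fun z => Metric.infDist z cantorSet) = cantorSet ∧
    ¬ (Zf (fun z => Metric.infDist z cantorSet)).Countable := by
  rw [Zf_infDist_cantorSet]
  exact ⟨rfl, not_countable_cantorSet⟩
end
end
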